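/- arXiv:2201.03944 — 4 statements merged into one kernel-verified Lean document; each statement's English description precedes it below -/
import Mathlib

section
/- For all rationals μ > 0 and χ > 1 with χ + μ/4 ≤ k := ⌈χ⌉, there exist ρ₀ > 0 and n₀ such that the following holds for all 0 < ρ ≤ ρ₀ and all n ≥ n₀. Set t = ⌈k^{4k}/(χ + 1 − k + μ/2)^k⌉, and let ℓ = t if k = 2 and ℓ = 1 if k ≥ 3. If G is a graph on n vertices with minimum degree δ(G) ≥ (1 − 1/χ + μ)n, then G is a μ/4-robust (χ + μ/4, ρ; t, ℓ)-tiling framework. -/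
open scoped Classical

namespace Paper

noncomputable section

variable {V : Type} [Fintype V]

/-- The degree of a vertex, via `Set.ncard`. -/
def ndeg (G : SimpleGraph V) (v : V) : ℕ := (G.neighborSet v).ncard

/-- A proper colouring with colours `0, …, k-1`. -/
def ProperCol (G : SimpleGraph V) (k : ℕ) (C : V → ℕ) : Prop :=
  (∀ v, C v < k) ∧ ∀ ⦃u v⦄, G.Adj u v → C u ≠ C v

/-- A topological colouring with colours `0, …, k-1`: every edge is monochromatic. -/
def TopCol (G : SimpleGraph V) (k : ℕ) (C : V → ℕ) : Prop :=
  (∀ v, C v < k) ∧ ∀ ⦃u v⦄, G.Adj u v → C u = C v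

/-- The size of the `i`-th colour class of a colouring. -/
def classCard (C : V → ℕ) (i : ℕ) : ℕ := {v | C v = i}.ncard

/-- The chromatic number, as a natural number. -/
def chromNum (G : SimpleGraph V) : ℕ := G.chromaticNumber.toNat

/-- The size of the smallest colour class of a colouring with `k` colours. -/
def minClassCard (C : V → ℕ) (k : ℕ) : ℕ := sInf {a | ∃ i < k, a = classCard C i}

/-- The minimum, over proper `χ(G)`-colourings, of the size of the smallest colour class. -/
def alphaNat (G : SimpleGraph V) : ℕ :=
  sInf {a | ∃ C, ProperCol G (chromNum G) C ∧ a = minClassCard C (chromNum G)}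

/-- `α(G)`: minimum proportion of vertices in a single colour class over proper
`χ(G)`-colourings. -/
def alphaR (G : SimpleGraph V) : ℝ := (alphaNat G : ℝ) / (Fintype.card V : ℝ)

/-- The critical chromatic number `crit(G) = (χ(G) − 1)/(1 − α(G))`. -/
def critR (G : SimpleGraph V) : ℝ := ((chromNum G : ℝ) - 1) / (1 - alphaR G)

/-- `𝒟(G)`: values `||φ⁻¹(0)| − |φ⁻¹(1)||` over proper `χ(G)`-colourings `φ`. -/
def DSet (G : SimpleGraph V) : Set ℕ :=
  {d | ∃ C, ProperCol G (chromNum G) C ∧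
    d = ((classCard C 0 : ℤ) - (classCard C 1 : ℤ)).natAbs}

/-- The set `S ⊆ ℕ` has greatest common divisor `1`.  (Elements `0` are immaterial, and this
fails when `S ⊆ {0}`, matching the convention `gcd = ∞` in that case.) -/
def GcdOne (S : Set ℕ) : Prop := ∃ T : Finset ℕ, ↑T ⊆ S ∧ T.gcd id = 1

/-- The orders of the connected components of `G`. -/
def compOrders (G : SimpleGraph V) : Set ℕ :=
  {m | ∃ c : G.ConnectedComponent, m = c.supp.ncard}

/-- Membership in the class `𝓕_cr`. -/
def IsFcr (G : SimpleGraph V) : Prop :=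
  (G.chromaticNumber = 2 ∧ GcdOne (DSet G) ∧ GcdOne (compOrders G)) ∨
  (3 ≤ G.chromaticNumber ∧ GcdOne (DSet G))

/-- `H` is a tiling whose tiles satisfy the (isomorphism-invariant) predicate `tile`:
the vertex set partitions into parts with no edges of `H` between distinct parts, each part
inducing a graph satisfying `tile`. -/
def IsTiling (H : SimpleGraph V) (tile : ∀ (W : Type) [Fintype W], SimpleGraph W → Prop) : Prop :=
  ∃ P : Set (Set V), Setoid.IsPartition P ∧
    (∀ p ∈ P, ∀ q ∈ P, p ≠ q → ∀ u ∈ p, ∀ v ∈ q, ¬ H.Adj u v) ∧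
    ∀ p ∈ P, tile ↥p (H.induce p)

/-- Tiles of order at most `w`. -/
def TileLe (w : ℕ) (W : Type) [Fintype W] (F : SimpleGraph W) : Prop := Fintype.card W ≤ w

/-- Tiles in `𝓕(k, w)`: properly `k`-colourable of order at most `w` (real bound `w`). -/
def TileCol (k : ℕ) (w : ℝ) (W : Type) [Fintype W] (F : SimpleGraph W) : Prop :=
  F.Colorable k ∧ (Fintype.card W : ℝ) ≤ w

/-- Tiles in `𝓕_cr(k, w)` (real bound `w`). -/
def TileFcr (k : ℕ) (w : ℝ) (W : Type) [Fintype W] (F : SimpleGraph W) : Prop :=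
  IsFcr F ∧ F.Colorable k ∧ (Fintype.card W : ℝ) ≤ w

/-- Tiles in `𝓕_c(k, w)` (real bound `w`). -/
def TileFc (k : ℕ) (w : ℝ) (W : Type) [Fintype W] (F : SimpleGraph W) : Prop :=
  GcdOne (compOrders F) ∧ F.Colorable k ∧ (Fintype.card W : ℝ) ≤ w

/-- Tiles isomorphic to a fixed graph `F₀`. -/
def TileIso {m : ℕ} (F₀ : SimpleGraph (Fin m)) (W : Type) [Fintype W]
    (F : SimpleGraph W) : Prop :=
  Nonempty (F ≃g F₀)

/-- `G` contains a copy of `H` as a (not necessarily induced) subgraph. -/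
def ContainsCopy {V' : Type} (G : SimpleGraph V) (H : SimpleGraph V') : Prop :=
  ∃ f : V' → V, Function.Injective f ∧ ∀ ⦃u v⦄, H.Adj u v → G.Adj (f u) (f v)

/-- `H` is properly `(k, s)`-flexi-chromatic. -/
def ProperlyFlexi (H : SimpleGraph V) (k s : ℕ) : Prop :=
  ∃ φ, ProperCol H k φ ∧ ∀ w : Fin k → ℤ, ∑ i, w i = 0 → (∀ i, |w i| ≤ (s : ℤ)) →
    ∃ φ', ProperCol H k φ' ∧
      ∀ i : Fin k, (classCard φ (i : ℕ) : ℤ) - classCard φ' (i : ℕ) = w i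

/-- `H` is topologically `(k, s)`-flexi-chromatic. -/
def TopFlexi (H : SimpleGraph V) (k s : ℕ) : Prop :=
  ∃ φ, TopCol H k φ ∧ ∀ w : Fin k → ℤ, ∑ i, w i = 0 → (∀ i, |w i| ≤ (s : ℤ)) →
    ∃ φ', TopCol H k φ' ∧
      ∀ i : Fin k, (classCard φ (i : ℕ) : ℤ) - classCard φ' (i : ℕ) = w i

/-- `A` is a union of connected components of `H` (the vertex set of a subtiling). -/
def CompClosed (H : SimpleGraph V) (A : Set V) : Prop :=
  ∀ ⦃u v⦄, H.Reachable u v → u ∈ A → v ∈ A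

/-- `H` contains `t` pairwise disjoint properly `(k, s)`-flexi-chromatic subtilings together
with one further disjoint topologically `(ℓ, s')`-flexi-chromatic subtiling, each of order at
most `w'`. -/
def HasFlexiSubtilings (H : SimpleGraph V) (t ℓ k s s' w' : ℕ) : Prop :=
  ∃ (A : Fin t → Set V) (B : Set V),
    (∀ i, CompClosed H (A i)) ∧ CompClosed H B ∧
    (∀ i j, i ≠ j → Disjoint (A i) (A j)) ∧ (∀ i, Disjoint (A i) B) ∧
    (∀ i, (A i).ncard ≤ w') ∧ B.ncard ≤ w' ∧
    (∀ i, ProperlyFlexi (H.induce (A i)) k s) ∧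
    TopFlexi (H.induce B) ℓ s'

/-- `H ∈ ℋ(n, w, Δ; χ; t, ℓ, w')`. -/
def InH (H : SimpleGraph V) (n w : ℕ) (Δ χ : ℝ) (t ℓ w' : ℕ) : Prop :=
  Fintype.card V ≤ n ∧ (∀ v, (ndeg H v : ℝ) ≤ Δ) ∧ IsTiling H (TileLe w) ∧
  critR H ≤ χ ∧ HasFlexiSubtilings H t ℓ ⌈χ⌉₊ (⌈χ⌉₊ * w) w w'

/-- The tight adjacency graph `T(J)` on the edge set `E` of a `k`-uniform hypergraph. -/
def TGraph (k : ℕ) (E : Set (Finset V)) : SimpleGraph ↥E :=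
  SimpleGraph.fromRel fun e f => ((e : Finset V) ∩ (f : Finset V)).card = k - 1

/-- The number of tight components. -/
def tightCount (k : ℕ) (E : Set (Finset V)) : ℕ := Nat.card (TGraph k E).ConnectedComponent

/-- The vertex support of a tight component. -/
def tcSupp (k : ℕ) (E : Set (Finset V)) (c : (TGraph k E).ConnectedComponent) : Set V :=
  {v | ∃ e : ↥E, (TGraph k E).connectedComponentMk e = c ∧ v ∈ (e : Finset V)}

/-- The loose adjacency graph `L(J)` on the tight components. -/
def LGraph (k : ℕ) (E : Set (Finset V)) : SimpleGraph (TGraph k E).ConnectedComponent :=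
  SimpleGraph.fromRel fun c c' => (tcSupp k E c ∩ tcSupp k E c').Nonempty

/-- The number of loose components. -/
def looseCount (k : ℕ) (E : Set (Finset V)) : ℕ := Nat.card (LGraph k E).ConnectedComponent

/-- `(t, ℓ)`-connectedness: some vertex-spanning subhypergraph has at most `t` tight
components and at most `ℓ` loose components. -/
def ConnectedTL (k : ℕ) (E : Set (Finset V)) (t ℓ : ℕ) : Prop :=
  ∃ E' ⊆ E, (∀ v : V, ∃ e ∈ E', v ∈ e) ∧ tightCount k E' ≤ t ∧ looseCount k E' ≤ ℓ

/-- Every vertex is linked to some edge. -/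
def Linked (k : ℕ) (E : Set (Finset V)) : Prop :=
  ∀ v : V, ∃ f ∈ E, v ∉ f ∧ ∃ e ∈ E, v ∈ e ∧ (e ∩ f).card = k - 1

/-- `ω` is a fractional `F`-tiling of `G`. -/
def IsFracTiling {α : Type} [Fintype α] (F : SimpleGraph α) (G : SimpleGraph V)
    (ω : (F →g G) → ℝ) : Prop :=
  (∀ θ, 0 ≤ ω θ ∧ ω θ ≤ 1) ∧
  ∀ v : V, (∑ᶠ θ : F →g G, ω θ * ({u | θ u = v}.ncard : ℝ)) ≤ 1

/-- The weight of a fractional tiling. -/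
def fracWeight {α : Type} [Fintype α] (F : SimpleGraph α) (G : SimpleGraph V)
    (ω : (F →g G) → ℝ) : ℝ :=
  (Fintype.card α : ℝ) * ∑ᶠ θ : F →g G, ω θ

/-- For a rational `q > 1`, the numerator `a` in `q = ⌊q⌋ + a/b`. -/
def aB (q : ℚ) : ℕ := (q - (⌊q⌋ : ℚ)).num.toNat

/-- For a rational `q > 1`, the denominator `b` in `q = ⌊q⌋ + a/b`. -/
def bB (q : ℚ) : ℕ := (q - (⌊q⌋ : ℚ)).den

/-- The bottle graph `B_q`: complete `⌈q⌉`-partite with one part of size `a` and the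
remaining `⌈q⌉ − 1` parts of size `b`. -/
def Bgraph (q : ℚ) : SimpleGraph (Σ i : Fin ⌈q⌉₊, Fin (if (i : ℕ) = 0 then aB q else bB q)) :=
  SimpleGraph.completeMultipartiteGraph fun i : Fin ⌈q⌉₊ => Fin (if (i : ℕ) = 0 then aB q else bB q)

/-- `G` is a `(q, ρ; t, ℓ)`-tiling framework. -/
def TilingFramework (G : SimpleGraph V) (q : ℚ) (ρ : ℝ) (t ℓ : ℕ) : Prop :=
  (∃ ω, IsFracTiling (Bgraph q) G ω ∧
      (1 - ρ) * (Fintype.card V : ℝ) ≤ fracWeight (Bgraph q) G ω) ∧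
  ConnectedTL ⌈q⌉₊ (G.cliqueSet ⌈q⌉₊) t ℓ ∧
  Linked ⌈q⌉₊ (G.cliqueSet ⌈q⌉₊)

/-- `G'` (on the vertex set `S`) is an `(ε, d)`-approximation of `G`. -/
def IsApprox (G : SimpleGraph V) (ε d : ℝ) (S : Set V) (G' : SimpleGraph ↥S) : Prop :=
  G' ≤ G.induce S ∧ (1 - ε) * (Fintype.card V : ℝ) ≤ (S.ncard : ℝ) ∧
  ∀ v : ↥S, (ndeg G (v : V) : ℝ) - d * (Fintype.card V : ℝ) ≤ (ndeg G' v : ℝ)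

/-- `G` is `μ`-robustly a `(q, ρ; t, ℓ)`-tiling framework. -/
def RobustFramework (G : SimpleGraph V) (μ : ℝ) (q : ℚ) (ρ : ℝ) (t ℓ : ℕ) : Prop :=
  ∀ (S : Set V) (G' : SimpleGraph ↥S), IsApprox G μ μ S G' → TilingFramework G' q ρ t ℓ

/-- `α(χ) = 1 − (⌈χ⌉ − 1)/χ`. -/
def alphaOf (χ : ℝ) : ℝ := 1 - ((⌈χ⌉₊ : ℝ) - 1) / χ

/-- The degree sequence of `G` is `(χ, μ)`-strong. -/
def DegSeqStrong (G : SimpleGraph V) (χ μ : ℝ) : Prop :=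
  ∃ e : Fin (Fintype.card V) ≃ V,
    (∀ i j, i ≤ j → ndeg G (e i) ≤ ndeg G (e j)) ∧
    ∀ i : Fin (Fintype.card V), ((i : ℕ) + 1 : ℝ) ≤ (Fintype.card V : ℝ) / χ →
      (1 - 1 / χ - alphaOf χ) * (Fintype.card V : ℝ) + χ * alphaOf χ * ((i : ℕ) + 1) +
          μ * (Fintype.card V : ℝ) ≤ (ndeg G (e i) : ℝ)

/-- `G` is uniformly `(ρ, d)`-dense. -/
def UniformlyDense (G : SimpleGraph V) (ρ d : ℝ) : Prop :=
  ∀ U : Set V, d * (U.ncard : ℝ) ^ 2 / 2 - ρ * (Fintype.card V : ℝ) ^ 2 ≤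
    ((G.induce U).edgeSet.ncard : ℝ)

/-- `p`-approximately `(k, s)`-flexi-chromatic with central colouring `φ`, generic in the
kind of colouring `Col` (proper or topological). -/
def ApproxFlexiWith {V : Type} (Col : ℕ → (V → ℕ) → Prop) (k s p : ℕ) (φ : V → ℕ) : Prop :=
  Col k φ ∧ ∀ w : Fin k → ℤ, ∑ i, w i = 0 → (∀ i, |w i| ≤ (s : ℤ)) →
    ∃ φ', Col k φ' ∧
      ∀ i : Fin k, |(classCard φ (i : ℕ) : ℤ) - classCard φ' (i : ℕ) - w i| ≤ (p : ℤ)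

/-- The vertex support of a hypergraph edge set. -/
def hsupp (E : Set (Finset V)) : Set V := {v | ∃ e ∈ E, v ∈ e}

/-- The reachability graph `ℛ(T)` on the vertex set of `T`. -/
def RGraph (k : ℕ) (T : Set (Finset V)) : SimpleGraph ↥(hsupp T) :=
  SimpleGraph.fromRel fun x y => ∃ e ∈ T, ∃ f ∈ T,
    (x : V) ∈ e ∧ (x : V) ∉ f ∧ (y : V) ∈ f ∧ (y : V) ∉ e ∧ (e ∩ f).card = k - 1

end

section Helpers

variable {V : Type} [Fintype V]

/-- The common neighbourhood of a finite set of vertices. -/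
noncomputable def commonNbrs (G : SimpleGraph V) (s : Finset V) : Finset V :=
  Finset.univ.filter fun w => ∀ v ∈ s, G.Adj v w

theorem mem_commonNbrs {G : SimpleGraph V} {s : Finset V} {w : V} :
    w ∈ commonNbrs G s ↔ ∀ v ∈ s, G.Adj v w := by
  simp [commonNbrs]

theorem commonNbrs_anti {G : SimpleGraph V} {s t : Finset V} (h : s ⊆ t) :
    commonNbrs G t ⊆ commonNbrs G s := fun w hw =>
  mem_commonNbrs.2 fun v hv => mem_commonNbrs.1 hw v (h hv)

theorem card_commonNbrs_ge {G : SimpleGraph V} {d : ℝ} (hd : ∀ v, d ≤ (ndeg G v : ℝ))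
    (s : Finset V) :
    (Fintype.card V : ℝ) - s.card * ((Fintype.card V : ℝ) - d) ≤ ((commonNbrs G s).card : ℝ) := by
  induction s using Finset.induction_on with
  | empty => simp [commonNbrs]
  | insert a s ha ih =>
    have hN : ndeg G a = (commonNbrs G {a}).card := by
      rw [ndeg, Set.ncard_eq_toFinset_card']
      congr 1
      ext w
      simp [commonNbrs]
    have hI : commonNbrs G (insert a s) = commonNbrs G s ∩ commonNbrs G {a} := by
      ext w
      simp [commonNbrs, and_comm]
    have h1 := Finset.card_union_add_card_inter (commonNbrs G s) (commonNbrs G {a})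
    have h2 : (commonNbrs G s ∪ commonNbrs G {a}).card ≤ Fintype.card V := Finset.card_le_univ _
    have h3 : (commonNbrs G s).card + (commonNbrs G {a}).card ≤
        Fintype.card V + (commonNbrs G (insert a s)).card := by
      rw [hI]; omega
    have h4 := hd a
    rw [hN] at h4
    rw [Finset.card_insert_of_notMem ha]
    have h5 : ((commonNbrs G s).card : ℝ) + (commonNbrs G {a}).card ≤
        Fintype.card V + (commonNbrs G (insert a s)).card := by exact_mod_cast h3
    push_cast
    linarith

theorem isNClique_insert_of_mem_commonNbrs {G : SimpleGraph V} {n : ℕ} {s : Finset V} {w : V}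
    (hs : G.IsNClique n s) (hw : w ∈ commonNbrs G s) : G.IsNClique (n + 1) (insert w s) :=
  hs.insert fun b hb => (mem_commonNbrs.1 hw b hb).symm

theorem exists_clique_extension {G : SimpleGraph V} {k : ℕ}
    (H : ∀ s : Finset V, s.card < k → (commonNbrs G s).Nonempty) {j : ℕ} (hj : j ≤ k)
    {s : Finset V} (hs : G.IsNClique j s) : ∃ e ∈ G.cliqueSet k, s ⊆ e := by
  induction hj using Nat.decreasingInduction generalizing s with
  | self => exact ⟨s, hs, subset_rfl⟩
  | of_succ j hj ih =>
    obtain ⟨w, hw⟩ := H s (by rw [hs.card_eq]; exact hj)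
    obtain ⟨e, he, hse⟩ := ih (isNClique_insert_of_mem_commonNbrs hs hw)
    exact ⟨e, he, (Finset.subset_insert _ _).trans hse⟩

theorem exists_clique_mem {G : SimpleGraph V} {k : ℕ} (hk : 1 ≤ k)
    (H : ∀ s : Finset V, s.card < k → (commonNbrs G s).Nonempty) (v : V) :
    ∃ e ∈ G.cliqueSet k, v ∈ e := by
  obtain ⟨e, he, hs⟩ := exists_clique_extension H hk
    (s := {v}) (by simp [SimpleGraph.isNClique_iff])
  exact ⟨e, he, hs (by simp)⟩

theorem isNClique_swap {G : SimpleGraph V} {k : ℕ} {e : Finset V} {r w : V}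
    (he : G.IsNClique k e) (hr : r ∈ e) (hw : w ∈ commonNbrs G (e.erase r)) :
    G.IsNClique k (insert w (e.erase r)) := by
  have hk : k - 1 + 1 = k := by
    have := Finset.card_pos.2 ⟨r, hr⟩
    rw [he.card_eq] at this
    omega
  have h1 : G.IsNClique (k - 1) (e.erase r) := he.erase_of_mem hr
  simpa [hk] using isNClique_insert_of_mem_commonNbrs h1 hw

theorem linked_of_commonNbrs {G : SimpleGraph V} {k : ℕ} (hk : 2 ≤ k)
    (H : ∀ s : Finset V, s.card < k → 1 < (commonNbrs G s).card) :
    Linked k (G.cliqueSet k) := by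
  intro v
  obtain ⟨e, he, hv⟩ := exists_clique_mem (G := G) (k := k) (by omega)
    (fun s hs => Finset.card_pos.1 ((Nat.zero_lt_one).trans (H s hs))) v
  have hcard : (e.erase v).card = k - 1 := by
    rw [Finset.card_erase_of_mem hv, he.card_eq]
  obtain ⟨w, hw, hne⟩ := Finset.exists_mem_ne (H (e.erase v) (by omega)) v
  refine ⟨insert w (e.erase v), isNClique_swap he hv hw, ?_, e, he, hv, ?_⟩
  · simp [hne.symm]
  · have hwe : w ∉ e := fun h =>
      G.irrefl (mem_commonNbrs.1 hw w (Finset.mem_erase.2 ⟨hne, h⟩))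
    rw [Finset.inter_insert_of_notMem hwe, Finset.inter_eq_right.2 (Finset.erase_subset _ _), hcard]

/-- Injective `j`-tuples that extend to an edge of the tight component `c`. -/
noncomputable def tuplesIn {k : ℕ} {E : Set (Finset V)} (c : (TGraph k E).ConnectedComponent) (j : ℕ) :
    Finset (Fin j → V) :=
  Finset.univ.filter fun f => Function.Injective f ∧
    ∃ e : ↥E, (TGraph k E).connectedComponentMk e = c ∧ ∀ i, f i ∈ (e : Finset V)

theorem card_extensions_ge {G : SimpleGraph V} {k : ℕ} {x : ℝ}
    (H : ∀ s : Finset V, s.card < k → x ≤ ((commonNbrs G s).card : ℝ))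
    (c : (TGraph k (G.cliqueSet k)).ConnectedComponent) {j : ℕ} (hj : j < k)
    {f : Fin j → V} (hf : f ∈ tuplesIn c j) :
    x ≤ ((Finset.univ.filter fun w => (Fin.cons w f : Fin (j + 1) → V) ∈ tuplesIn c (j + 1)).card
      : ℝ) := by
  obtain ⟨hinj, ⟨e, he⟩, hec, hfe⟩ := (Finset.mem_filter.1 hf).2
  have he' : G.IsNClique k e := he
  obtain ⟨r, hr, hrf⟩ : ∃ r ∈ e, r ∉ Finset.univ.image f := by
    apply Finset.exists_mem_notMem_of_card_lt_card
    rw [he'.card_eq]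
    exact Finset.card_image_le.trans_lt (by simpa using hj)
  have hcard : (e.erase r).card = k - 1 := by
    rw [Finset.card_erase_of_mem hr, he'.card_eq]
  have hfr : ∀ i, f i ∈ e.erase r := fun i => Finset.mem_erase.2
    ⟨fun h => hrf (Finset.mem_image.2 ⟨i, Finset.mem_univ _, h⟩), hfe i⟩
  refine (H (e.erase r) (by omega)).trans ?_
  refine Nat.cast_le.2 (Finset.card_le_card fun w hw => ?_)
  have hwe : w ∉ e.erase r := fun h => G.irrefl (mem_commonNbrs.1 hw w h)
  refine Finset.mem_filter.2 ⟨Finset.mem_univ _, Finset.mem_filter.2 ⟨Finset.mem_univ _, ?_, ?_⟩⟩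
  · refine Fin.cons_injective_iff.2 ⟨?_, hinj⟩
    rintro ⟨i, rfl⟩
    exact hwe (hfr i)
  · have hclique : insert w (e.erase r) ∈ G.cliqueSet k := isNClique_swap he' hr hw
    refine ⟨⟨_, hclique⟩, ?_, ?_⟩
    · rw [← hec]
      by_cases hwr : w = r
      · subst hwr
        congr 2
        exact Finset.insert_erase hr
      · have hw' : w ∉ e := fun h => hwe (Finset.mem_erase.2 ⟨hwr, h⟩)
        apply SimpleGraph.ConnectedComponent.sound
        apply SimpleGraph.Adj.reachable
        refine (SimpleGraph.fromRel_adj _ _ _).2 ⟨?_, Or.inl ?_⟩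
        · intro h
          apply hw'
          rw [← show insert w (e.erase r) = e from congrArg Subtype.val h]
          exact Finset.mem_insert_self _ _
        · change (insert w (e.erase r) ∩ e).card = k - 1
          rw [Finset.insert_inter_of_notMem hw',
            Finset.inter_eq_left.2 (Finset.erase_subset _ _), hcard]
    · intro i
      refine Fin.cases ?_ (fun i => ?_) i
      · exact Finset.mem_insert_self _ _
      · exact Finset.mem_insert_of_mem (hfr i)

theorem pow_le_card_tuplesIn {G : SimpleGraph V} {k : ℕ} {x : ℝ} (hx : 0 ≤ x)
    (H : ∀ s : Finset V, s.card < k → x ≤ ((commonNbrs G s).card : ℝ))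
    (c : (TGraph k (G.cliqueSet k)).ConnectedComponent) {j : ℕ} (hj : j ≤ k) :
    x ^ j ≤ ((tuplesIn c j).card : ℝ) := by
  induction j with
  | zero =>
    have : (tuplesIn c 0).Nonempty := by
      obtain ⟨e, rfl⟩ := c.exists_rep
      exact ⟨Fin.elim0, Finset.mem_filter.2 ⟨Finset.mem_univ _,
        Function.injective_of_subsingleton _, e, rfl, fun i => i.elim0⟩⟩
    simpa using this
  | succ j ih =>
    let W : (Fin j → V) → Finset V := fun f =>
      Finset.univ.filter fun w => (Fin.cons w f : Fin (j + 1) → V) ∈ tuplesIn c (j + 1)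
    have h1 : ((tuplesIn c j).sigma W).card ≤ (tuplesIn c (j + 1)).card := by
      refine Finset.card_le_card_of_injOn (fun p => Fin.cons p.2 p.1) ?_ ?_
      · rintro ⟨f, w⟩ hp
        exact (Finset.mem_filter.1 (Finset.mem_sigma.1 hp).2).2
      · rintro ⟨f, w⟩ - ⟨f', w'⟩ - h
        obtain ⟨h1, h2⟩ := Fin.cons_injective2 h
        subst h1 h2
        rfl
    rw [Finset.card_sigma] at h1
    calc x ^ (j + 1) = x ^ j * x := pow_succ _ _
      _ ≤ (tuplesIn c j).card * x := mul_le_mul_of_nonneg_right (ih (by omega)) hx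
      _ = ∑ _f ∈ tuplesIn c j, x := by simp
      _ ≤ ∑ f ∈ tuplesIn c j, ((W f).card : ℝ) :=
        Finset.sum_le_sum fun f hf => card_extensions_ge H c (by omega) hf
      _ ≤ (tuplesIn c (j + 1)).card := by exact_mod_cast h1

theorem tightCount_mul_pow_le {G : SimpleGraph V} {k : ℕ} {x : ℝ} (hx : 0 ≤ x)
    (H : ∀ s : Finset V, s.card < k → x ≤ ((commonNbrs G s).card : ℝ)) :
    (tightCount k (G.cliqueSet k) : ℝ) * x ^ k ≤ (Fintype.card V : ℝ) ^ k := by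
  have : Fintype (TGraph k (G.cliqueSet k)).ConnectedComponent := Fintype.ofFinite _
  have hdisj : ((Finset.univ : Finset (TGraph k (G.cliqueSet k)).ConnectedComponent) :
      Set (TGraph k (G.cliqueSet k)).ConnectedComponent).PairwiseDisjoint fun c => tuplesIn c k := by
    intro c _ c' _ hne
    refine Finset.disjoint_left.2 fun f hf hf' => hne ?_
    obtain ⟨hinj, e, rfl, he⟩ := (Finset.mem_filter.1 hf).2
    obtain ⟨-, e', rfl, he'⟩ := (Finset.mem_filter.1 hf').2
    have key : ∀ a : ↥(G.cliqueSet k), (∀ i, f i ∈ (a : Finset V)) →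
        Finset.univ.image f = (a : Finset V) := by
      intro a ha
      apply Finset.eq_of_subset_of_card_le
      · intro v hv
        obtain ⟨i, -, rfl⟩ := Finset.mem_image.1 hv
        exact ha i
      · rw [Finset.card_image_of_injective _ hinj, Finset.card_univ, Fintype.card_fin]
        exact (a.2 : G.IsNClique k a).card_eq.le
    rw [Subtype.ext ((key e he).symm.trans (key e' he'))]
  have h1 := Finset.card_biUnion hdisj
  have h2 : (Finset.univ.biUnion fun c : (TGraph k (G.cliqueSet k)).ConnectedComponent =>
      tuplesIn c k).card ≤ Fintype.card V ^ k :=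
    (Finset.card_le_univ _).trans (by simp)
  rw [h1] at h2
  calc (tightCount k (G.cliqueSet k) : ℝ) * x ^ k
      = ∑ _c : (TGraph k (G.cliqueSet k)).ConnectedComponent, x ^ k := by
        simp [tightCount, Nat.card_eq_fintype_card]
    _ ≤ ∑ c : (TGraph k (G.cliqueSet k)).ConnectedComponent, ((tuplesIn c k).card : ℝ) :=
        Finset.sum_le_sum fun c _ => pow_le_card_tuplesIn hx H c le_rfl
    _ ≤ _ := by exact_mod_cast h2

theorem looseCount_le_tightCount (k : ℕ) (E : Set (Finset V)) :
    looseCount k E ≤ tightCount k E :=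
  Nat.card_le_card_of_surjective _ Quot.mk_surjective

theorem lGraph_reachable_of_mem {V : Type} {k : ℕ} {E : Set (Finset V)} {e f : ↥E} {v : V}
    (he : v ∈ (e : Finset V)) (hf : v ∈ (f : Finset V)) :
    (LGraph k E).Reachable ((TGraph k E).connectedComponentMk e)
      ((TGraph k E).connectedComponentMk f) := by
  by_cases h : (TGraph k E).connectedComponentMk e = (TGraph k E).connectedComponentMk f
  · rw [h]
  · exact SimpleGraph.Adj.reachable ((SimpleGraph.fromRel_adj _ _ _).2
      ⟨h, Or.inl ⟨v, ⟨e, rfl, he⟩, ⟨f, rfl, hf⟩⟩⟩)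

theorem looseCount_le_one {G : SimpleGraph V} {k : ℕ} (hk : 3 ≤ k)
    (H : ∀ s : Finset V, s.card < k → (commonNbrs G s).Nonempty) :
    looseCount k (G.cliqueSet k) ≤ 1 := by
  have hadj : ∀ {u v : V}, G.Adj u v → ∀ e f : ↥(G.cliqueSet k), u ∈ (e : Finset V) →
      v ∈ (f : Finset V) → (LGraph k (G.cliqueSet k)).Reachable
        ((TGraph k _).connectedComponentMk e) ((TGraph k _).connectedComponentMk f) := by
    intro u v huv e f hu hv
    obtain ⟨g, hg, huvg⟩ := exists_clique_extension H (j := 2) (by omega) (s := {u, v})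
      ((SimpleGraph.isNClique_iff G).2 ⟨by simpa [SimpleGraph.isClique_pair] using fun _ => huv,
        Finset.card_pair huv.ne⟩)
    have h1 : u ∈ g := huvg (by simp)
    have h2 : v ∈ g := huvg (by simp)
    exact (lGraph_reachable_of_mem (f := ⟨g, hg⟩) hu h1).trans (lGraph_reachable_of_mem h2 hv)
  have hsub : Subsingleton (LGraph k (G.cliqueSet k)).ConnectedComponent := by
    refine ⟨fun a b => ?_⟩
    obtain ⟨c, rfl⟩ := a.exists_rep
    obtain ⟨c', rfl⟩ := b.exists_rep
    obtain ⟨e, rfl⟩ := c.exists_rep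
    obtain ⟨f, rfl⟩ := c'.exists_rep
    apply SimpleGraph.ConnectedComponent.sound
    have hne : ∀ a : ↥(G.cliqueSet k), (a : Finset V).Nonempty := fun a =>
      Finset.card_pos.1 (by rw [(a.2 : G.IsNClique k a).card_eq]; omega)
    obtain ⟨u, hu⟩ := hne e
    obtain ⟨v, hv⟩ := hne f
    obtain ⟨w, hw⟩ := H {u, v} (Finset.card_le_two.trans_lt (by omega))
    have huw : G.Adj u w := mem_commonNbrs.1 hw u (by simp)
    have hvw : G.Adj v w := mem_commonNbrs.1 hw v (by simp)
    obtain ⟨g, hg, hwg⟩ := exists_clique_mem (by omega) H w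
    exact (hadj huw e ⟨g, hg⟩ hu hwg).trans (hadj hvw.symm ⟨g, hg⟩ f hwg hv)
  exact Finite.card_le_one_iff_subsingleton.2 hsub

theorem sum_hom_eq {α : Type} [Fintype α] (θ : α → V) (y : V → ℝ) :
    ∑ v, ({u | θ u = v}.ncard : ℝ) * y v = ∑ u, y (θ u) := by
  rw [← Finset.sum_fiberwise Finset.univ θ fun u => y (θ u)]
  refine Finset.sum_congr rfl fun v _ => ?_
  rw [Finset.sum_congr rfl fun u hu => by rw [(Finset.mem_filter.1 hu).2], Finset.sum_const,
    nsmul_eq_mul, Set.ncard_eq_toFinset_card', Set.toFinset_ofPred]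

/-- A Farkas-type criterion for perfect fractional tilings. -/
theorem exists_perfect_fracTiling {α : Type} [Fintype α] [Nonempty α] [Nonempty V]
    (F : SimpleGraph α) (G : SimpleGraph V)
    (h : ∀ y : V → ℝ, ∃ θ : F →g G,
      (Fintype.card V : ℝ) * ∑ u, y (θ u) ≤ (Fintype.card α : ℝ) * ∑ v, y v) :
    ∃ ω, IsFracTiling F G ω ∧ fracWeight F G ω = Fintype.card V := by
  have : Finite (F →g G) := Finite.of_injective _ DFunLike.coe_injective
  have : Fintype (F →g G) := Fintype.ofFinite _
  have hm : (0 : ℝ) < Fintype.card V := by exact_mod_cast Fintype.card_pos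
  have hα : (0 : ℝ) < Fintype.card α := by exact_mod_cast Fintype.card_pos
  let X : (F →g G) → V → ℝ := fun θ v => ({u | θ u = v}.ncard : ℝ)
  let L : ((F →g G) → ℝ) →ₗ[ℝ] (V → ℝ) := Fintype.linearCombination ℝ X
  have hL : ∀ ω v, L ω v = ∑ θ, ω θ * X θ v := by
    intro ω v
    simp [L, Fintype.linearCombination_apply, Finset.sum_apply]
  have hmem : (fun _ => (Fintype.card α : ℝ) / Fintype.card V) ∈
      L '' stdSimplex ℝ (F →g G) := by
    by_contra hnot
    obtain ⟨f, u, hfu, hft⟩ := geometric_hahn_banach_point_closed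
      ((convex_stdSimplex ℝ (F →g G)).linear_image L)
      (((isCompact_stdSimplex ℝ (F →g G)).image
        L.continuous_of_finiteDimensional).isClosed) hnot
    let y : V → ℝ := fun v => f (Pi.single v 1)
    have hf : ∀ z : V → ℝ, f z = ∑ v, z v * y v := by
      intro z
      conv_lhs => rw [pi_eq_sum_univ' z]
      simp [y, map_sum, Pi.single]
    obtain ⟨θ, hθ⟩ := h y
    have h1 := hft (X θ) ⟨Pi.single θ 1, single_mem_stdSimplex ℝ θ, by simp [L]⟩
    rw [hf, sum_hom_eq] at h1
    rw [hf, ← Finset.mul_sum] at hfu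
    have h2 := hfu.trans h1
    rw [div_mul_eq_mul_div, div_lt_iff₀ hm] at h2
    linarith
  obtain ⟨ω, ⟨hω0, hω1⟩, hω⟩ := hmem
  have hsum : ∀ v, ∑ θ, ω θ * X θ v = Fintype.card α / Fintype.card V := fun v => by
    rw [← hL, hω]
  have hscaled : ∀ v, ∑ θ, Fintype.card V / Fintype.card α * ω θ * X θ v = 1 := fun v => by
    simp_rw [mul_assoc]
    rw [← Finset.mul_sum, hsum]
    field_simp
  have hnn : ∀ θ, 0 ≤ (Fintype.card V : ℝ) / Fintype.card α * ω θ := fun θ =>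
    mul_nonneg (by positivity) (hω0 θ)
  refine ⟨fun θ => Fintype.card V / Fintype.card α * ω θ, ⟨fun θ => ⟨hnn θ, ?_⟩, fun v => ?_⟩, ?_⟩
  · obtain ⟨u⟩ := ‹Nonempty α›
    have hX : (1 : ℝ) ≤ X θ (θ u) := by
      have : 0 < {u' | θ u' = θ u}.ncard := (Set.ncard_pos (Set.toFinite _)).2 ⟨u, rfl⟩
      exact Nat.one_le_cast.2 this
    calc (Fintype.card V : ℝ) / Fintype.card α * ω θ
        ≤ Fintype.card V / Fintype.card α * ω θ * X θ (θ u) := le_mul_of_one_le_right (hnn θ) hX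
      _ ≤ ∑ θ', Fintype.card V / Fintype.card α * ω θ' * X θ' (θ u) :=
        Finset.single_le_sum (f := fun θ' => Fintype.card V / Fintype.card α * ω θ' * X θ' (θ u))
          (fun θ' _ => mul_nonneg (hnn θ') (Nat.cast_nonneg _)) (Finset.mem_univ θ)
      _ = 1 := hscaled _
  · rw [finsum_eq_sum_of_fintype]
    exact (hscaled v).le
  · rw [fracWeight, finsum_eq_sum_of_fintype, ← Finset.mul_sum, hω1]
    field_simp

theorem exists_greedy_clique {G : SimpleGraph V} {k : ℕ} [Nonempty V]
    (H : ∀ s : Finset V, s.card < k → (commonNbrs G s).Nonempty) (y : V → ℝ) :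
    ∃ v : ℕ → V, ∀ i < k, v i ∈ commonNbrs G ((Finset.range i).image v) ∧
      ∀ w ∈ commonNbrs G ((Finset.range i).image v), y (v i) ≤ y w := by
  suffices ∀ j ≤ k, ∃ v : ℕ → V, ∀ i < j, v i ∈ commonNbrs G ((Finset.range i).image v) ∧
      ∀ w ∈ commonNbrs G ((Finset.range i).image v), y (v i) ≤ y w from this k le_rfl
  intro j
  induction j with
  | zero => exact fun _ => ⟨fun _ => Classical.arbitrary V, fun i hi => absurd hi (by omega)⟩
  | succ j ih =>
    intro hj
    obtain ⟨v, hv⟩ := ih (by omega)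
    obtain ⟨w, hw, hmin⟩ := Finset.exists_min_image _ y
      (H ((Finset.range j).image v) (Finset.card_image_le.trans_lt (by simpa using hj)))
    have himg : ∀ i ≤ j, (Finset.range i).image (Function.update v j w) =
        (Finset.range i).image v := by
      intro i hi
      refine Finset.image_congr fun l hl => Function.update_of_ne ?_ _ _
      have := Finset.mem_range.1 (Finset.mem_coe.1 hl)
      omega
    refine ⟨Function.update v j w, fun i hi => ?_⟩
    rw [himg i (by omega)]
    rcases eq_or_ne i j with rfl | hne
    · simpa using ⟨hw, hmin⟩
    · rw [Function.update_of_ne hne]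
      exact hv i (by omega)

theorem add_sum_steps_le {c : ℕ → ℝ} {K : ℕ} (hc : ∀ i < K, c i ≤ c (i + 1)) {y : ℝ}
    (hy : c 0 ≤ y) :
    c 0 + ∑ i ∈ Finset.range K, (c (i + 1) - c i) * (if c (i + 1) ≤ y then 1 else 0) ≤ y := by
  induction K with
  | zero => simpa using hy
  | succ K ih =>
    by_cases h : c (K + 1) ≤ y
    · refine le_trans ?_ h
      have h1 : ∑ i ∈ Finset.range (K + 1),
          (c (i + 1) - c i) * (if c (i + 1) ≤ y then (1 : ℝ) else 0) ≤
          ∑ i ∈ Finset.range (K + 1), (c (i + 1) - c i) := by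
        refine Finset.sum_le_sum fun i hi => ?_
        have := hc i (Finset.mem_range.1 hi)
        split_ifs <;> linarith
      rw [Finset.sum_range_sub] at h1
      linarith
    · rw [Finset.sum_range_succ, if_neg h, mul_zero, add_zero]
      exact ih fun i hi => hc i (by omega)

theorem sum_steps_eq (c : ℕ → ℝ) (N b : ℝ) (K : ℕ) :
    N * c 0 + ∑ i ∈ Finset.range K, (c (i + 1) - c i) * (N - (i + 1) * b) =
      b * ∑ i ∈ Finset.range K, c i + (N - K * b) * c K := by
  induction K with
  | zero => simp
  | succ K ih =>
    rw [Finset.sum_range_succ, Finset.sum_range_succ, ← add_assoc, ih]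
    push_cast
    ring

theorem exists_perfect_bottle_tiling [Nonempty V] {G : SimpleGraph V} {K a b : ℕ}
    (hN : 0 < K * b + a)
    (H : ∀ s : Finset V, s.card < K + 1 → (commonNbrs G s).Nonempty)
    (hdeg : ∀ s : Finset V, ((K * b + a : ℕ) : ℝ) * (Fintype.card V - (commonNbrs G s).card) ≤
      s.card * b * Fintype.card V) :
    ∃ ω, IsFracTiling (SimpleGraph.completeMultipartiteGraph
        fun i : Fin (K + 1) => Fin (if (i : ℕ) = 0 then a else b)) G ω ∧
      fracWeight (SimpleGraph.completeMultipartiteGraph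
        fun i : Fin (K + 1) => Fin (if (i : ℕ) = 0 then a else b)) G ω = Fintype.card V := by
  have hcard : Fintype.card (Σ i : Fin (K + 1), Fin (if (i : ℕ) = 0 then a else b)) =
      K * b + a := by
    simp [Fin.sum_univ_succ, add_comm]
  have : Nonempty (Σ i : Fin (K + 1), Fin (if (i : ℕ) = 0 then a else b)) :=
    Fintype.card_pos_iff.1 (hcard ▸ hN)
  refine exists_perfect_fracTiling _ _ fun y => ?_
  obtain ⟨v, hv⟩ := exists_greedy_clique H y
  have hadj : ∀ {i j}, i < j → j < K + 1 → G.Adj (v i) (v j) := fun {i j} hij hj =>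
    mem_commonNbrs.1 (hv j hj).1 _ (Finset.mem_image_of_mem v (Finset.mem_range.2 hij))
  have hadj' : ∀ {i j}, i ≠ j → i < K + 1 → j < K + 1 → G.Adj (v i) (v j) :=
    fun {i j} hij hi hj => by
      rcases lt_or_gt_of_ne hij with h | h
      · exact hadj h hj
      · exact (hadj h hi).symm
  refine ⟨⟨fun u => v (K - u.1), fun {u u'} huu' => ?_⟩, ?_⟩
  · have hne : u.1 ≠ u'.1 := huu'
    have h1 := u.1.2
    have h2 := u'.1.2
    have h3 : (u.1 : ℕ) ≠ u'.1 := fun h => hne (Fin.ext h)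
    exact hadj' (by omega) (by omega) (by omega)
  set c : ℕ → ℝ := fun i => y (v i) with hc
  have hmono : ∀ i < K, c i ≤ c (i + 1) := fun i hi =>
    (hv i (by omega)).2 _ (commonNbrs_anti
      (Finset.image_subset_image (Finset.range_mono (Nat.le_succ i))) (hv (i + 1) (by omega)).1)
  have hmin : ∀ w, c 0 ≤ y w := fun w => (hv 0 (by omega)).2 w (by simp [commonNbrs])
  have hsum : ∑ u : (Σ i : Fin (K + 1), Fin (if (i : ℕ) = 0 then a else b)), y (v (K - u.1)) =
      b * ∑ i ∈ Finset.range K, c i + a * c K := by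
    rw [Fintype.sum_sigma, Fin.sum_univ_succ]
    simp only [Finset.sum_const, Finset.card_univ, Fintype.card_fin, nsmul_eq_mul, Fin.val_zero,
      Fin.val_succ, Nat.succ_ne_zero, if_false, Nat.sub_zero]
    rw [← Finset.mul_sum, Fin.sum_univ_eq_sum_range (fun i : ℕ => y (v (K - (i + 1)))) K,
      ← Finset.sum_range_reflect c K, add_comm]
    simp only [hc, Nat.sub_sub, Nat.add_comm 1]
    congr 3
    exact Fintype.card_fin a
  set N : ℝ := ((K * b + a : ℕ) : ℝ) with hNdef
  have hcount : ∀ i < K, (Fintype.card V : ℝ) * (N - (i + 1) * b) ≤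
      N * ∑ w, (if c (i + 1) ≤ y w then (1 : ℝ) else 0) := by
    intro i hi
    have h1 := hdeg ((Finset.range (i + 1)).image v)
    have h2 : (((Finset.range (i + 1)).image v).card : ℝ) ≤ i + 1 := by
      have := Finset.card_image_le (s := Finset.range (i + 1)) (f := v)
      rw [Finset.card_range] at this
      exact_mod_cast this
    have h3 : ((commonNbrs G ((Finset.range (i + 1)).image v)).card : ℝ) ≤
        ∑ w, (if c (i + 1) ≤ y w then (1 : ℝ) else 0) := by
      rw [Finset.sum_boole]
      exact_mod_cast Finset.card_le_card fun w hw =>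
        Finset.mem_filter.2 ⟨Finset.mem_univ _, (hv (i + 1) (by omega)).2 w hw⟩
    have h4 : (((Finset.range (i + 1)).image v).card : ℝ) * b * Fintype.card V ≤
        (i + 1) * b * Fintype.card V := by gcongr
    have h5 := mul_le_mul_of_nonneg_left h3 (show 0 ≤ N by positivity)
    linarith
  have hpt : ∑ w, (c 0 + ∑ i ∈ Finset.range K,
      (c (i + 1) - c i) * (if c (i + 1) ≤ y w then 1 else 0)) ≤ ∑ w, y w :=
    Finset.sum_le_sum fun w _ => add_sum_steps_le hmono (hmin w)
  rw [Finset.sum_add_distrib, Finset.sum_comm, Finset.sum_const, Finset.card_univ,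
    nsmul_eq_mul] at hpt
  rw [hcard]
  change (Fintype.card V : ℝ) *
    ∑ u : (Σ i : Fin (K + 1), Fin (if (i : ℕ) = 0 then a else b)), y (v (K - u.1)) ≤ _
  rw [hsum]
  have ha : (a : ℝ) = N - K * b := by rw [hNdef]; push_cast; ring
  rw [ha, ← sum_steps_eq c N b K]
  calc (Fintype.card V : ℝ) * (N * c 0 + ∑ i ∈ Finset.range K, (c (i + 1) - c i) *
        (N - (i + 1) * b))
      = N * (Fintype.card V * c 0) + ∑ i ∈ Finset.range K, (c (i + 1) - c i) *
        (Fintype.card V * (N - (i + 1) * b)) := by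
        rw [mul_add, Finset.mul_sum]
        congr 1
        · ring
        · exact Finset.sum_congr rfl fun i _ => by ring
    _ ≤ N * (Fintype.card V * c 0) + ∑ i ∈ Finset.range K, (c (i + 1) - c i) *
        (N * ∑ w, (if c (i + 1) ≤ y w then (1 : ℝ) else 0)) := by
        refine add_le_add le_rfl (Finset.sum_le_sum fun i hi => ?_)
        have hi := Finset.mem_range.1 hi
        exact mul_le_mul_of_nonneg_left (hcount i hi) (sub_nonneg.2 (hmono i hi))
    _ = N * (Fintype.card V * c 0 + ∑ i ∈ Finset.range K, ∑ w, (c (i + 1) - c i) *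
        (if c (i + 1) ≤ y w then (1 : ℝ) else 0)) := by
        rw [mul_add, Finset.mul_sum]
        congr 1
        refine Finset.sum_congr rfl fun i _ => ?_
        rw [← Finset.mul_sum]
        ring
    _ ≤ N * ∑ w, y w := mul_le_mul_of_nonneg_left hpt (by positivity)

theorem bottle_order_le {q : ℚ} (hq : 0 < q) :
    (((⌈q⌉₊ - 1 : ℕ) * bB q + aB q : ℕ) : ℚ) ≤ q * bB q := by
  have hb : (0 : ℚ) < bB q := by exact_mod_cast (q - (⌊q⌋ : ℚ)).den_pos
  have hfr : (aB q : ℚ) = (q - ⌊q⌋) * bB q := by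
    have h1 : 0 ≤ (q - (⌊q⌋ : ℚ)).num := Rat.num_nonneg.2 (sub_nonneg.2 (Int.floor_le q))
    have h2 : (aB q : ℚ) = ((q - (⌊q⌋ : ℚ)).num : ℚ) := by
      rw [aB]
      exact_mod_cast Int.toNat_of_nonneg h1
    rw [h2, bB]
    exact (Rat.mul_den_eq_num _).symm
  have hc : ((⌈q⌉₊ - 1 : ℕ) : ℚ) ≤ ⌊q⌋ := by
    have h1 : ((⌈q⌉₊ : ℕ) : ℤ) = ⌈q⌉ := Int.natCast_ceil_eq_ceil hq.le
    have h2 : ⌈q⌉ ≤ ⌊q⌋ + 1 := Int.ceil_le_floor_add_one q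
    have h3 : 0 < ⌈q⌉₊ := Nat.ceil_pos.2 hq
    have h4 : ((⌈q⌉₊ - 1 : ℕ) : ℤ) ≤ ⌊q⌋ := by omega
    exact_mod_cast h4
  push_cast [hfr]
  nlinarith [mul_le_mul_of_nonneg_right hc hb.le]

theorem exists_perfect_bgraph_tiling [Nonempty V] {G : SimpleGraph V} {q : ℚ} (hq : 1 < q)
    (H : ∀ s : Finset V, s.card < ⌈q⌉₊ → (commonNbrs G s).Nonempty)
    (hdeg : ∀ v, (1 - 1 / (q : ℝ)) * Fintype.card V ≤ ndeg G v) :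
    ∃ ω, IsFracTiling (Bgraph q) G ω ∧ fracWeight (Bgraph q) G ω = Fintype.card V := by
  have hk : 2 ≤ ⌈q⌉₊ := Nat.lt_ceil.2 (by exact_mod_cast hq)
  have hb : 0 < bB q := (q - (⌊q⌋ : ℚ)).den_pos
  have hle : (((⌈q⌉₊ - 1 : ℕ) * bB q + aB q : ℕ) : ℝ) ≤ q * bB q := by
    exact_mod_cast bottle_order_le (zero_lt_one.trans hq)
  have hq0 : (0 : ℝ) < q := by exact_mod_cast zero_lt_one.trans hq
  have hdeg' : ∀ s : Finset V, (((⌈q⌉₊ - 1 : ℕ) * bB q + aB q : ℕ) : ℝ) *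
      (Fintype.card V - (commonNbrs G s).card) ≤ s.card * bB q * Fintype.card V := by
    intro s
    have h1 := card_commonNbrs_ge hdeg s
    have h2 : (Fintype.card V : ℝ) - (commonNbrs G s).card ≤ s.card * (Fintype.card V / q) := by
      have : (Fintype.card V : ℝ) - (1 - 1 / (q : ℝ)) * Fintype.card V = Fintype.card V / q := by
        ring
      rw [this] at h1
      linarith
    calc _ ≤ (((⌈q⌉₊ - 1 : ℕ) * bB q + aB q : ℕ) : ℝ) * (s.card * (Fintype.card V / q)) := by
          gcongr
      _ ≤ (q * bB q) * (s.card * (Fintype.card V / q)) := by gcongr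
      _ = _ := by field_simp
  revert hk H hdeg'
  unfold Bgraph
  generalize ⌈q⌉₊ = k
  intro H hk hdeg'
  obtain ⟨K, rfl⟩ : ∃ K, k = K + 1 := ⟨k - 1, by omega⟩
  exact exists_perfect_bottle_tiling
    (Nat.add_pos_left (Nat.mul_pos (by omega) hb) _) H hdeg'

theorem tilingFramework_of_commonNbrs [Nonempty V] {G : SimpleGraph V} {q : ℚ} (hq : 1 < q)
    {x ρ : ℝ} (hx : 1 < x) (hρ : 0 < ρ)
    (H : ∀ s : Finset V, s.card < ⌈q⌉₊ → x ≤ ((commonNbrs G s).card : ℝ))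
    (hdeg : ∀ v, (1 - 1 / (q : ℝ)) * Fintype.card V ≤ ndeg G v) {t : ℕ}
    (ht : (Fintype.card V : ℝ) ^ ⌈q⌉₊ ≤ t * x ^ ⌈q⌉₊) :
    TilingFramework G q ρ t (if ⌈q⌉₊ = 2 then t else 1) := by
  have hk : 2 ≤ ⌈q⌉₊ := Nat.lt_ceil.2 (by exact_mod_cast hq)
  have H1 : ∀ s : Finset V, s.card < ⌈q⌉₊ → 1 < (commonNbrs G s).card := fun s hs => by
    exact_mod_cast hx.trans_le (H s hs)
  have H0 : ∀ s : Finset V, s.card < ⌈q⌉₊ → (commonNbrs G s).Nonempty := fun s hs =>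
    Finset.card_pos.1 (Nat.zero_lt_one.trans (H1 s hs))
  have htight : tightCount ⌈q⌉₊ (G.cliqueSet ⌈q⌉₊) ≤ t := by
    have h1 := (tightCount_mul_pow_le (zero_le_one.trans hx.le) H).trans ht
    exact_mod_cast le_of_mul_le_mul_right h1 (pow_pos (zero_lt_one.trans hx) _)
  refine ⟨?_, ⟨_, subset_rfl, exists_clique_mem (by omega) H0, htight, ?_⟩,
    linked_of_commonNbrs hk H1⟩
  · obtain ⟨ω, hω, hw⟩ := exists_perfect_bgraph_tiling hq H0 hdeg
    refine ⟨ω, hω, ?_⟩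
    rw [hw]
    have : (0 : ℝ) ≤ ρ * Fintype.card V := by positivity
    linarith
  · split_ifs with h
    · exact (looseCount_le_tightCount _ _).trans htight
    · exact looseCount_le_one (by omega) H0

end Helpers

/-- Lemma 2.6 (minimum degree gives a robust tiling framework). -/
theorem deg_gives_framework (μ χ : ℚ) (hμ : 0 < μ) (hχ : 1 < χ)
    (hk : χ + μ / 4 ≤ (⌈χ⌉₊ : ℚ)) :
    ∃ ρ₀ : ℝ, 0 < ρ₀ ∧ ∃ n₀ : ℕ, ∀ ρ : ℝ, 0 < ρ → ρ ≤ ρ₀ → ∀ n : ℕ, n₀ ≤ n →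
      ∀ G : SimpleGraph (Fin n),
      (∀ v, (1 - 1 / (χ : ℝ) + (μ : ℝ)) * n ≤ (ndeg G v : ℝ)) →
      RobustFramework G ((μ : ℝ) / 4) (χ + μ / 4) ρ
        (⌈((⌈χ⌉₊ : ℚ) ^ (4 * ⌈χ⌉₊) / (χ + 1 - (⌈χ⌉₊ : ℚ) + μ / 2) ^ ⌈χ⌉₊ : ℚ)⌉₊)
        (if ⌈χ⌉₊ = 2 then
          ⌈((⌈χ⌉₊ : ℚ) ^ (4 * ⌈χ⌉₊) / (χ + 1 - (⌈χ⌉₊ : ℚ) + μ / 2) ^ ⌈χ⌉₊ : ℚ)⌉₊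
        else 1) := by
  have hceil : ⌈χ + μ / 4⌉₊ = ⌈χ⌉₊ :=
    le_antisymm (Nat.ceil_le.2 hk) (Nat.ceil_mono (by linarith))
  have hq : 1 < χ + μ / 4 := by linarith
  rw [← hceil] at hk ⊢
  have hklt : ((⌈χ + μ / 4⌉₊ : ℕ) : ℚ) < χ + 1 := by
    rw [hceil]; exact Nat.ceil_lt_add_one (by linarith)
  have hk2 : 2 ≤ ⌈χ + μ / 4⌉₊ := Nat.lt_ceil.2 (by exact_mod_cast hq)
  have hμR : (0 : ℝ) < μ := by exact_mod_cast hμ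
  have hχR : (1 : ℝ) < χ := by exact_mod_cast hχ
  have hkR : (χ : ℝ) + μ / 4 ≤ (⌈χ + μ / 4⌉₊ : ℝ) := by exact_mod_cast hk
  have hkltR : (⌈χ + μ / 4⌉₊ : ℝ) < χ + 1 := by exact_mod_cast hklt
  have hk2R : (2 : ℝ) ≤ ⌈χ + μ / 4⌉₊ := by exact_mod_cast hk2
  refine ⟨1, one_pos, ⌈4 * (⌈χ + μ / 4⌉₊ : ℝ) / μ⌉₊ + 1, fun ρ hρ _ n hn G hG S G' hG' => ?_⟩
  obtain ⟨-, hS, hdeg⟩ := hG'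
  have hn' : 4 * (⌈χ + μ / 4⌉₊ : ℝ) / μ < n :=
    (Nat.le_ceil _).trans_lt (by exact_mod_cast hn)
  rw [div_lt_iff₀ hμR] at hn'
  have hn0 : (0 : ℝ) < n := by
    exact_mod_cast (Nat.succ_pos _).trans_le hn
  have hinv : 1 / (χ : ℝ) ≤ 1 := by
    rw [div_le_one (by linarith)]; linarith
  have hμ1 : (μ : ℝ) < 1 := by
    have v : Fin n := ⟨0, by exact_mod_cast hn0⟩
    have h1 := hG v
    have h2 : (ndeg G v : ℝ) ≤ n := by
      have : ndeg G v ≤ Nat.card (Fin n) := Set.ncard_le_card _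
      rw [Nat.card_eq_fintype_card, Fintype.card_fin] at this
      exact_mod_cast this
    have h3 : (1 - 1 / (χ : ℝ) + μ) ≤ 1 := by
      by_contra! h
      nlinarith
    have h4 : 1 / (χ : ℝ) < 1 := by
      rw [div_lt_one (by linarith)]; exact hχR
    linarith
  simp only [Fintype.card_fin] at hS hdeg
  have hcardS : Fintype.card ↥S = S.ncard := by
    rw [← Nat.card_eq_fintype_card, Nat.card_coe_set_eq]
  rw [← hcardS] at hS
  have hmn : (Fintype.card ↥S : ℝ) ≤ n := by
    have : S.ncard ≤ Nat.card (Fin n) := Set.ncard_le_card _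
    rw [Nat.card_eq_fintype_card, Fintype.card_fin, ← hcardS] at this
    exact_mod_cast this
  have hm34 : 3 / 4 * (n : ℝ) ≤ Fintype.card ↥S := by nlinarith
  have hm0 : (0 : ℝ) < Fintype.card ↥S := by linarith
  have : Nonempty ↥S := Fintype.card_pos_iff.1 (by exact_mod_cast hm0)
  have hd : ∀ v, (1 - 1 / (χ : ℝ) + 3 / 4 * μ) * Fintype.card ↥S ≤ (ndeg G' v : ℝ) := by
    intro v
    have h1 := hG v
    have h2 := hdeg v
    have h3 : (1 - 1 / (χ : ℝ) + 3 / 4 * μ) * Fintype.card ↥S ≤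
        (1 - 1 / (χ : ℝ) + 3 / 4 * μ) * n :=
      mul_le_mul_of_nonneg_left hmn (by linarith)
    linarith
  set k := ⌈χ + μ / 4⌉₊ with hkdef
  set m : ℝ := ((Fintype.card ↥S : ℕ) : ℝ) with hmdef
  set β : ℝ := χ + 1 - k + μ / 2 with hβ
  have hβμ : (μ : ℝ) / 2 < β := by rw [hβ]; linarith
  have hβ0 : 0 < β := by linarith
  have hk0 : (0 : ℝ) < k := by linarith
  refine tilingFramework_of_commonNbrs hq (x := β * m / k) ?_ hρ ?_ ?_ ?_
  · rw [lt_div_iff₀ hk0]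
    nlinarith
  · intro s hs
    refine le_trans ?_ (card_commonNbrs_ge hd s)
    rw [← hmdef]
    have hs' : (s.card : ℝ) ≤ k - 1 := by
      have : (s.card : ℝ) + 1 ≤ k := by exact_mod_cast hs
      linarith
    have h0 : 0 ≤ m - (1 - 1 / (χ : ℝ) + 3 / 4 * μ) * m := by
      obtain ⟨v⟩ := this
      have h1 := hd v
      have h2 : ndeg G' v ≤ Nat.card ↥S := Set.ncard_le_card _
      rw [Nat.card_eq_fintype_card] at h2
      have h3 : (ndeg G' v : ℝ) ≤ m := Nat.cast_le.2 h2
      linarith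
    have h1 := mul_le_mul_of_nonneg_right hs' h0
    refine le_trans ?_ (sub_le_sub_left h1 m)
    have h2 : β / k ≤ β / χ := by
      apply div_le_div_of_nonneg_left hβ0.le <;> linarith
    have h3 : β / χ ≤ 1 - ((k : ℝ) - 1) * (1 / χ - 3 / 4 * μ) := by
      rw [div_le_iff₀ (by linarith)]
      have h4 : (1 - ((k : ℝ) - 1) * (1 / χ - 3 / 4 * μ)) * χ =
          χ - (k - 1) + (k - 1) * χ * (3 / 4 * μ) := by
        field_simp
        ring
      have h5 : (1 : ℝ) ≤ (k - 1) * χ := by nlinarith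
      have h6 := mul_le_mul_of_nonneg_right h5 (show (0 : ℝ) ≤ 3 / 4 * μ by positivity)
      rw [h4, hβ]
      linarith
    have h7 := mul_le_mul_of_nonneg_right (h2.trans h3) hm0.le
    calc β * m / k = β / k * m := by ring
      _ ≤ _ := h7
      _ = _ := by ring
  · intro v
    refine le_trans (mul_le_mul_of_nonneg_right ?_ hm0.le) (hd v)
    push_cast
    have h1 : 1 / (χ : ℝ) - 1 / (χ + μ / 4) ≤ μ / 4 := by
      rw [div_sub_div _ _ (by linarith) (by linarith), div_le_iff₀ (by nlinarith)]
      have h2 : (1 : ℝ) ≤ χ * (χ + μ / 4) := by nlinarith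
      nlinarith
    linarith
  · have h1 : ((k : ℝ) ^ (4 * k) / β ^ k) ≤
        (⌈((k : ℚ) ^ (4 * k) / (χ + 1 - (k : ℚ) + μ / 2) ^ k : ℚ)⌉₊ : ℝ) := by
      have h2 := Nat.le_ceil ((k : ℚ) ^ (4 * k) / (χ + 1 - (k : ℚ) + μ / 2) ^ k : ℚ)
      have h3 : (((k : ℚ) ^ (4 * k) / (χ + 1 - (k : ℚ) + μ / 2) ^ k : ℚ) : ℝ) ≤
          ((⌈((k : ℚ) ^ (4 * k) / (χ + 1 - (k : ℚ) + μ / 2) ^ k : ℚ)⌉₊ : ℚ) : ℝ) :=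
        Rat.cast_le.2 h2
      push_cast at h3
      exact h3
    have h4 : (k : ℝ) ^ k / β ^ k ≤ (k : ℝ) ^ (4 * k) / β ^ k := by
      gcongr
      · linarith
      · omega
    calc m ^ k = (k : ℝ) ^ k / β ^ k * (β * m / k) ^ k := by
          rw [div_pow, mul_pow]
          field_simp
      _ ≤ _ := mul_le_mul_of_nonneg_right (h4.trans h1) (by positivity)

end Paper
end

section
/- Let n, w, w′, t, Δ be positive integers, let χ > 1 and set k = ⌈χ⌉; let ℓ = t if k = 2 and ℓ = 1 if k ≥ 3. Let H be a tiling on at most n vertices with Δ(H) ≤ Δ, every tile of order at most w, and crit(H) ≤ χ, and suppose that either (a) H is an 𝓕_cr(k,w)-tiling and w′ ≥ (k+ℓ)^{10} w² log w, or (b) H is an F-tiling for a single graph F ∈ 𝓕_cr(k,w) and w′ ≥ (k+ℓ)^{10} w². If moreover v(H) ≥ (t+ℓ)w′, then H contains t pairwise disjoint properly (k, kw)-flexi-chromatic subtilings and one further disjoint topological (ℓ, w)-flexi-chromatic subtiling, each of order at most w′. -/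
open scoped Classical

namespace Paper

/-! ### Subset sums -/

theorem gcd_mem_of_forall_mem (K : AddSubgroup ℤ) (T : Finset ℕ) (h : ∀ x ∈ T, (x : ℤ) ∈ K) :
    ((T.gcd id : ℕ) : ℤ) ∈ K := by
  induction T using Finset.induction_on with
  | empty => simp
  | insert a T ha ih =>
    rw [Finset.gcd_insert]
    have h1 : (a : ℤ) ∈ K := h a (by simp)
    have h2 := ih fun x hx => h x (by simp [hx])
    change ((Nat.gcd a (T.gcd id) : ℕ) : ℤ) ∈ K
    rw [Nat.gcd_eq_gcd_ab, mul_comm (a : ℤ), mul_comm ((T.gcd id : ℕ) : ℤ)]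
    exact K.add_mem (by simpa using K.zsmul_mem h1 _) (by simpa using K.zsmul_mem h2 _)

theorem GcdOne.exists_pos {D : Set ℕ} (h : GcdOne D) : ∃ q ∈ D, 0 < q := by
  obtain ⟨T, hT, hg⟩ := h
  by_contra! hc
  have : T.gcd id = 0 := Finset.gcd_eq_zero_iff.2 fun x hx => by
    simpa using hc x (hT hx)
  omega

/-- The sums of the integers `d i` over subsets of `I`, in a ring `G`. -/
noncomputable def subsetSums (G : Type*) [CommRing G] {ι : Type*} (d : ι → ℕ) (I : Finset ι) :
    Finset G :=
  I.powerset.image fun T => ∑ i ∈ T, (d i : G)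

theorem mem_subsetSums {G ι : Type*} [CommRing G] {d : ι → ℕ} {I : Finset ι} {x : G} :
    x ∈ subsetSums G d I ↔ ∃ T ⊆ I, ∑ i ∈ T, (d i : G) = x := by
  simp [subsetSums]

/-- The set `S` together with its translate by `x`. -/
noncomputable def withTranslate {G : Type*} [CommRing G] (S : Finset G) (x : G) : Finset G :=
  S ∪ S.image (· + x)

theorem subset_withTranslate {G : Type*} [CommRing G] (S : Finset G) (x : G) :
    S ⊆ withTranslate S x :=
  Finset.subset_union_left

theorem subsetSums_insert {G ι : Type*} [CommRing G] (d : ι → ℕ) {I : Finset ι} {a : ι}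
    (ha : a ∉ I) (x : ℕ) :
    subsetSums G (Function.update d a x) (insert a I) =
      withTranslate (subsetSums G d I) (x : G) := by
  have key : ∀ T ⊆ I, ∑ i ∈ T, (Function.update d a x i : G) = ∑ i ∈ T, (d i : G) := by
    intro T hT
    refine Finset.sum_congr rfl fun i hi => ?_
    rw [Function.update_of_ne]
    rintro rfl
    exact ha (hT hi)
  ext y
  simp only [withTranslate, subsetSums, Finset.powerset_insert, Finset.image_union, Finset.image_image,
    Finset.mem_union, Finset.mem_image, Finset.mem_powerset, Function.comp]
  refine or_congr (exists_congr fun T => and_congr_right fun hT => by rw [key T hT])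
    (exists_congr fun T => and_congr_right fun hT => ?_)
  rw [Finset.sum_insert (fun h => ha (hT h)), key T hT, Function.update_self, add_comm]

/-- Choosing the summands one at a time, keeping an invariant of the set of subset sums. -/
theorem exists_subsetSums_invariant {G ι : Type*} [CommRing G] (D : ι → Set ℕ)
    (Φ : ℕ → Finset G → Prop) (h0 : Φ 0 {0})
    (step : ∀ i n S, Φ n S → ∃ x ∈ D i, Φ (n + 1) (withTranslate S (x : G)))
    (I : Finset ι) : ∃ d : ι → ℕ, (∀ i ∈ I, d i ∈ D i) ∧ Φ I.card (subsetSums G d I) := by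
  induction I using Finset.induction_on with
  | empty => exact ⟨fun _ => 0, by simp, by simpa [subsetSums] using h0⟩
  | insert a I ha ih =>
    obtain ⟨d, hd, hΦ⟩ := ih
    obtain ⟨x, hx, hΦ'⟩ := step a _ _ hΦ
    refine ⟨Function.update d a x, fun i hi => ?_, ?_⟩
    · rcases eq_or_ne i a with rfl | hia
      · simpa using hx
      · rw [Function.update_of_ne hia]
        exact hd i (by simpa [hia] using hi)
    · rwa [Finset.card_insert_of_notMem ha, subsetSums_insert d ha]

/-- The number of elements of `S` that are moved out of `S` by the translation by `x`. -/
noncomputable def boundary {G : Type*} [CommRing G] (S : Finset G) (x : G) : ℕ :=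
  {a ∈ S | a + x ∉ S}.card

theorem boundary_pos {G : Type*} [CommRing G] {S : Finset G} {x a : G} (ha : a ∈ S)
    (hax : a + x ∉ S) : 0 < boundary S x :=
  Finset.card_pos.2 ⟨a, Finset.mem_filter.2 ⟨ha, hax⟩⟩

theorem card_withTranslate {G : Type*} [CommRing G] (S : Finset G) (x : G) :
    (withTranslate S x).card = S.card + boundary S x := by
  have h : withTranslate S x = S ∪ {a ∈ S | a + x ∉ S}.image (· + x) := by
    unfold withTranslate
    ext y
    simp only [Finset.mem_union, Finset.mem_image, Finset.mem_filter]
    constructor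
    · rintro (h | ⟨a, ha, rfl⟩)
      · exact Or.inl h
      · by_cases hs : a + x ∈ S
        exacts [Or.inl hs, Or.inr ⟨a, ⟨ha, hs⟩, rfl⟩]
    · rintro (h | ⟨a, ha, rfl⟩)
      exacts [Or.inl h, Or.inr ⟨a, ha.1, rfl⟩]
  rw [h, Finset.card_union_of_disjoint, Finset.card_image_of_injective _ (add_left_injective x)]
  · rfl
  · refine Finset.disjoint_left.2 fun y hy hy' => ?_
    obtain ⟨a, ha, rfl⟩ := Finset.mem_image.1 hy'
    exact (Finset.mem_filter.1 ha).2 hy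

theorem eq_univ_of_translates {q : ℕ} [NeZero q] {D : Set ℕ} (hD : GcdOne D)
    {S : Finset (ZMod q)} (hS : S.Nonempty)
    (h : ∀ x ∈ D, ∀ a ∈ S, a + (x : ZMod q) ∈ S) : S = Finset.univ := by
  let K : AddSubgroup ℤ :=
    { carrier := {z | ∀ a, a ∈ S ↔ a + (z : ZMod q) ∈ S}
      zero_mem' := by simp
      add_mem' := fun {x y} hx hy a => by
        rw [hx a, hy, Int.cast_add, add_assoc]
      neg_mem' := fun {x} hx a => by
        rw [hx (a + ((-x : ℤ) : ZMod q))]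
        simp }
  have hK : ∀ x ∈ D, (x : ℤ) ∈ K := by
    intro x hx a
    have he : S.image (· + (x : ZMod q)) = S :=
      Finset.eq_of_subset_of_card_le (Finset.image_subset_iff.2 (h x hx))
        (Finset.card_image_of_injective _ (add_left_injective _)).ge
    constructor
    · intro ha
      simpa using h x hx a ha
    · intro ha
      rw [← he] at ha
      obtain ⟨b, hb, hba⟩ := Finset.mem_image.1 ha
      have : b = a := by simpa using hba
      exact this ▸ hb
  obtain ⟨T, hT, hg⟩ := hD
  have h1 : (1 : ℤ) ∈ K := by
    have := gcd_mem_of_forall_mem K T fun x hx => hK x (hT hx)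
    simpa [hg] using this
  obtain ⟨a, ha⟩ := hS
  refine Finset.eq_univ_iff_forall.2 fun b => ?_
  have h2 : ((b - a).val : ℤ) ∈ K := by simpa using K.zsmul_mem h1 ((b - a).val : ℤ)
  have := (h2 a).1 ha
  simpa using this

/-- Enough summands from a set of greatest common divisor `1` reach every residue class. -/
theorem exists_subsetSums_eq_univ {ι : Type*} {D : Set ℕ} (hD : GcdOne D) {q : ℕ} (hq : 0 < q)
    (I : Finset ι) (hI : q ≤ I.card + 1) :
    ∃ d : ι → ℕ, (∀ i ∈ I, d i ∈ D) ∧ ∀ x : ℤ, ∃ T ⊆ I, (q : ℤ) ∣ x - ∑ i ∈ T, (d i : ℤ) := by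
  have : NeZero q := ⟨hq.ne'⟩
  obtain ⟨d, hd, hc⟩ := exists_subsetSums_invariant (G := ZMod q) (fun _ : ι => D)
    (fun n S => min (n + 1) q ≤ S.card) (by simp) (by
      intro i n S hS
      have hne : S.Nonempty := Finset.card_pos.1 (by omega)
      by_cases h : ∀ x ∈ D, ∀ a ∈ S, a + (x : ZMod q) ∈ S
      · have hu := eq_univ_of_translates hD hne h
        obtain ⟨x, hx, -⟩ := hD.exists_pos
        refine ⟨x, hx, ?_⟩
        have := card_withTranslate S (x : ZMod q)
        have h2 : S.card = q := by rw [hu, Finset.card_univ, ZMod.card]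
        omega
      · push Not at h
        obtain ⟨x, hx, a, ha, hxS⟩ := h
        refine ⟨x, hx, ?_⟩
        have := card_withTranslate S (x : ZMod q)
        have h2 : 0 < boundary S (x : ZMod q) := boundary_pos ha hxS
        omega) I
  refine ⟨d, hd, fun x => ?_⟩
  have hu : subsetSums (ZMod q) d I = Finset.univ := by
    refine Finset.eq_univ_of_card _ (le_antisymm (Finset.card_le_univ _) ?_)
    rw [ZMod.card]
    omega
  have hx : (x : ZMod q) ∈ subsetSums (ZMod q) d I := hu ▸ Finset.mem_univ _
  obtain ⟨T, hT, hTx⟩ := mem_subsetSums.1 hx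
  refine ⟨T, hT, (ZMod.intCast_zmod_eq_zero_iff_dvd _ q).1 ?_⟩
  push_cast
  rw [hTx, sub_self]

/-- The subset sums of the `d i` contain every integer at distance at most `s` from some
centre. -/
def Covers {ι : Type*} (d : ι → ℕ) (s : ℕ) : Prop :=
  ∃ x₀ : ℤ, ∀ z : ℤ, |z| ≤ s → ∃ T : Finset ι, ∑ i ∈ T, (d i : ℤ) = x₀ + z

theorem sum_mem_bounds {ι : Type*} {d : ι → ℕ} {w : ℕ} {I T : Finset ι}
    (hd : ∀ i ∈ I, d i ≤ w) (hT : T ⊆ I) :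
    0 ≤ ∑ i ∈ T, (d i : ℤ) ∧ ∑ i ∈ T, (d i : ℤ) ≤ I.card * w := by
  refine ⟨by positivity, ?_⟩
  have h1 : ∑ i ∈ T, d i ≤ T.card * w := by
    simpa using Finset.sum_le_card_nsmul T d w fun i hi => hd i (hT hi)
  have h2 : T.card * w ≤ I.card * w := Nat.mul_le_mul_right _ (Finset.card_le_card hT)
  exact_mod_cast h1.trans h2

theorem exists_covers_of_const {ι : Type*} [Fintype ι] {D : Set ℕ} (hD : GcdOne D) {w κ : ℕ}
    (hw : ∀ x ∈ D, x ≤ w) (hκ : 0 < κ) (hι : 4 * κ * w ≤ Fintype.card ι) :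
    ∃ d : ι → ℕ, (∀ i, d i ∈ D) ∧ Covers d (κ * w) := by
  obtain ⟨q, hqD, hq⟩ := hD.exists_pos
  have hqw := hw q hqD
  have hkw : w ≤ κ * w := Nat.le_mul_of_pos_left _ hκ
  have e4 : 4 * κ * w = 4 * (κ * w) := by ring
  obtain ⟨I, -, hI⟩ := Finset.exists_subset_card_eq
    (show q - 1 ≤ (Finset.univ : Finset ι).card by rw [Finset.card_univ]; omega)
  have hIc : w + 2 * (κ * w) ≤ Iᶜ.card := by rw [Finset.card_compl]; omega
  obtain ⟨d, hd, hcov⟩ := exists_subsetSums_eq_univ hD hq I (by omega)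
  refine ⟨fun i => if i ∈ I then d i else q, fun i => ?_, (q * w + κ * w : ℕ), fun z hz => ?_⟩
  · dsimp only
    split_ifs with h
    exacts [hd i h, hqD]
  set y : ℤ := ((q * w + κ * w : ℕ) : ℤ) + z with hy
  obtain ⟨T, hT, c, hc⟩ := hcov y
  obtain ⟨h0, h1⟩ := sum_mem_bounds (w := w) (fun i hi => hw _ (hd i hi)) hT
  rw [hI] at h1
  push_cast [Nat.cast_sub (show 1 ≤ q from hq)] at h1 hy hz
  rw [abs_le] at hz
  have hq' : (1 : ℤ) ≤ q := by exact_mod_cast hq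
  have hw' : (0 : ℤ) ≤ w := by positivity
  have hc0 : 0 ≤ c := by
    by_contra! hneg
    nlinarith
  have hkw0 : (0 : ℤ) ≤ κ * w := by positivity
  have hc1 : c ≤ w + 2 * (κ * w) := by
    by_contra! hgt
    nlinarith [mul_le_mul_of_nonneg_left (show (w : ℤ) + 2 * (κ * w) + 1 ≤ c by omega)
      (show (0 : ℤ) ≤ q by omega), mul_le_mul_of_nonneg_right hq' hkw0]
  lift c to ℕ using hc0
  obtain ⟨T', hT', hT'c⟩ := Finset.exists_subset_card_eq
    (show c ≤ Iᶜ.card from le_trans (by exact_mod_cast hc1) hIc)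
  have hnot : ∀ i ∈ T', i ∉ I := fun i hi => Finset.mem_compl.1 (hT' hi)
  refine ⟨T ∪ T', ?_⟩
  rw [Finset.sum_union (Finset.disjoint_left.2 fun i hi hi' => hnot i hi' (hT hi)),
    Finset.sum_congr rfl (g := fun i => (d i : ℤ)) fun i hi => by simp [hT hi],
    Finset.sum_congr (s₁ := T') rfl (g := fun _ => (q : ℤ)) fun i hi => by simp [hnot i hi],
    Finset.sum_const, hT'c, nsmul_eq_mul]
  linarith

theorem boundary_def (S : Finset ℤ) (x : ℤ) : boundary S x = {a ∈ S | a + x ∉ S}.card := by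
  unfold boundary
  congr!

theorem boundary_zero (S : Finset ℤ) : boundary S 0 = 0 := by
  simp [boundary]

theorem boundary_neg (S : Finset ℤ) (x : ℤ) : boundary S (-x) = boundary S x := by
  have h1 := Finset.card_filter_add_card_filter_not (s := S) (p := fun a => a + x ∈ S)
  have h2 := Finset.card_filter_add_card_filter_not (s := S) (p := fun a => a + -x ∈ S)
  have h3 : {a ∈ S | a + x ∈ S}.card = {a ∈ S | a + -x ∈ S}.card := by
    refine Finset.card_bij' (fun a _ => a + x) (fun a _ => a + -x) ?_ ?_ ?_ ?_ <;>
      simp +contextual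
  simp only [boundary_def]
  omega

theorem boundary_add_le (S : Finset ℤ) (x y : ℤ) :
    boundary S (x + y) ≤ boundary S x + boundary S y := by
  have h : {a ∈ S | a + (x + y) ∉ S} ⊆
      {a ∈ S | a + x ∉ S} ∪ ({a ∈ S | a + y ∉ S}).image (· - x) := by
    intro a ha
    obtain ⟨h1, h2⟩ := Finset.mem_filter.1 ha
    by_cases hx : a + x ∈ S
    · refine Finset.mem_union_right _ (Finset.mem_image.2 ⟨a + x, ?_, by ring⟩)
      exact Finset.mem_filter.2 ⟨hx, by rwa [add_assoc]⟩
    · exact Finset.mem_union_left _ (Finset.mem_filter.2 ⟨h1, hx⟩)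
  simp only [boundary_def]
  exact (Finset.card_le_card h).trans ((Finset.card_union_le _ _).trans
    (Nat.add_le_add_left Finset.card_image_le _))

theorem boundary_sum_le {ι : Type*} (S : Finset ℤ) (T : Finset ι) (f : ι → ℤ) {δ : ℕ}
    (h : ∀ i ∈ T, boundary S (f i) ≤ δ) : boundary S (∑ i ∈ T, f i) ≤ T.card * δ := by
  induction T using Finset.induction_on with
  | empty => simp [boundary_zero]
  | insert a T ha ih =>
    rw [Finset.sum_insert ha, Finset.card_insert_of_notMem ha]
    have h1 := boundary_add_le S (f a) (∑ i ∈ T, f i)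
    have h2 := h a (by simp)
    have h3 := ih fun i hi => h i (by simp [hi])
    linarith

theorem boundary_mul_le (S : Finset ℤ) (c x : ℤ) :
    boundary S (c * x) ≤ c.natAbs * boundary S x := by
  have key : ∀ n : ℕ, boundary S (n * x) ≤ n * boundary S x := by
    intro n
    simpa using boundary_sum_le S (Finset.range n) (fun _ => x) fun i _ => le_refl _
  obtain ⟨n, rfl | rfl⟩ := c.eq_nat_or_neg
  · simpa using key n
  · rw [neg_mul, boundary_neg]
    simpa using key n

/-- If the translations by a set of greatest common divisor `1` move few elements of `S`, then
so do all short translations. -/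
theorem boundary_le_of_gcdOne {D : Set ℕ} (hD : GcdOne D) {w κ : ℕ} (hw : ∀ x ∈ D, x ≤ w)
    (hκ : 0 < κ) (S : Finset ℤ) {δ : ℕ} (hδ : ∀ x ∈ D, boundary S (x : ℤ) ≤ δ) {x : ℤ}
    (hx0 : 0 ≤ x) (hx : x ≤ 2 * κ * w) : boundary S x ≤ 3 * κ * w * δ := by
  obtain ⟨q, hqD, hq⟩ := hD.exists_pos
  have hqw := hw q hqD
  obtain ⟨d, hd, hcov⟩ := exists_subsetSums_eq_univ hD hq (Finset.range (q - 1)) (by simp; omega)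
  obtain ⟨T, hT, c, hc⟩ := hcov x
  obtain ⟨h0, h1⟩ := sum_mem_bounds (w := w) (fun i hi => hw _ (hd i hi)) hT
  have hTc : T.card ≤ q - 1 := by simpa using Finset.card_le_card hT
  rw [Finset.card_range] at h1
  push_cast [Nat.cast_sub (show 1 ≤ q from hq)] at h1
  have hq' : (1 : ℤ) ≤ q := by exact_mod_cast hq
  have hκ' : (1 : ℤ) ≤ κ := by exact_mod_cast hκ
  have hw' : (0 : ℤ) ≤ w := by positivity
  have hkw' : (w : ℤ) ≤ κ * w := by nlinarith
  have hqkw : (κ * w : ℤ) ≤ q * (κ * w) := by nlinarith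
  have hqkw' : (q * w : ℤ) ≤ q * (κ * w) := by nlinarith
  have hc1 : c ≤ 2 * (κ * w) := by
    by_contra! hgt
    nlinarith
  have hc2 : -(2 * (κ * w)) ≤ c := by
    by_contra! hgt
    nlinarith
  have hc3 : c.natAbs ≤ 2 * (κ * w) := by zify; exact abs_le.2 ⟨hc2, hc1⟩
  have e : x = ∑ i ∈ T, (d i : ℤ) + c * q := by linarith
  have b1 := boundary_sum_le S T (fun i => (d i : ℤ)) fun i hi => hδ _ (hd i (hT hi))
  have b2 := (boundary_mul_le S c q).trans (Nat.mul_le_mul hc3 (hδ q hqD))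
  have b3 := boundary_add_le S (∑ i ∈ T, (d i : ℤ)) (c * q)
  have hkw : w ≤ κ * w := Nat.le_mul_of_pos_left _ hκ
  have b4 : T.card * δ ≤ κ * w * δ := Nat.mul_le_mul_right _ (by omega)
  rw [e]
  calc _ ≤ κ * w * δ + 2 * (κ * w) * δ := by omega
    _ = _ := by ring

/-- `S` contains more than three quarters of some interval of length `s`. -/
def LocallyDense (s : ℕ) (S : Finset ℤ) : Prop :=
  ∃ a : ℤ, 4 * {x ∈ Finset.Icc (1 : ℤ) s | a + x ∉ S}.card < s

theorem exists_boundary_of_not_locallyDense {s : ℕ} (hs : 0 < s) {S : Finset ℤ}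
    (h : ¬ LocallyDense s S) : ∃ x : ℤ, 0 ≤ x ∧ x ≤ s ∧ S.card ≤ 4 * boundary S x := by
  simp only [LocallyDense, not_exists, not_lt] at h
  by_contra! hc
  have h1 : ∑ x ∈ Finset.Icc (1 : ℤ) s, boundary S x =
      ∑ a ∈ S, {x ∈ Finset.Icc (1 : ℤ) s | a + x ∉ S}.card := by
    simp only [boundary_def, Finset.card_filter]
    exact Finset.sum_comm
  have h2 : S.card * s ≤ ∑ a ∈ S, 4 * {x ∈ Finset.Icc (1 : ℤ) s | a + x ∉ S}.card := by
    simpa using Finset.card_nsmul_le_sum S _ s fun a _ => h a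
  have h3 : ∑ x ∈ Finset.Icc (1 : ℤ) s, 4 * boundary S x < ∑ x ∈ Finset.Icc (1 : ℤ) s, S.card := by
    refine Finset.sum_lt_sum_of_nonempty ⟨(1 : ℤ), Finset.mem_Icc.2 ⟨le_refl _, by omega⟩⟩ fun x hx => ?_
    obtain ⟨hx1, hx2⟩ := Finset.mem_Icc.1 hx
    exact hc x (by omega) hx2
  rw [← Finset.mul_sum, h1, Finset.mul_sum] at h3
  simp at h3
  linarith [mul_comm S.card s]

/-- Two locally dense sets sum to a set containing an interval. -/
theorem LocallyDense.exists_add {s : ℕ} {S S' : Finset ℤ} (h : LocallyDense (2 * s) S)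
    (h' : LocallyDense (2 * s) S') :
    ∃ x₀ : ℤ, ∀ z : ℤ, |z| ≤ s → ∃ b ∈ S, ∃ b' ∈ S', b + b' = x₀ + z := by
  obtain ⟨a, ha⟩ := h
  obtain ⟨a', ha'⟩ := h'
  refine ⟨a + a' + 2 * s + 1, fun z hz => ?_⟩
  rw [abs_le] at hz
  by_contra! hc
  have hsub : Finset.Icc (1 : ℤ) (2 * s : ℕ) ⊆
      ({x ∈ Finset.Icc (1 : ℤ) (2 * s : ℕ) | a + x ∉ S} ∪
        ({x ∈ Finset.Icc (1 : ℤ) (2 * s : ℕ) | a' + x ∉ S'}).image (fun y => 2 * s + 1 + z - y)) ∪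
      (Finset.Icc (1 : ℤ) z ∪ Finset.Icc (2 * s + z + 1 : ℤ) (2 * s)) := by
    intro x hx
    rw [Finset.mem_Icc] at hx
    push_cast at hx
    by_cases h1 : a + x ∈ S
    · have h2 : a' + (2 * s + 1 + z - x) ∉ S' := fun h2 => hc _ h1 _ h2 (by ring)
      by_cases h3 : 1 ≤ 2 * s + 1 + z - x ∧ 2 * s + 1 + z - x ≤ 2 * s
      · refine Finset.mem_union_left _ (Finset.mem_union_right _ (Finset.mem_image.2
          ⟨2 * s + 1 + z - x, Finset.mem_filter.2 ⟨Finset.mem_Icc.2 ?_, h2⟩, by ring⟩))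
        push_cast
        exact h3
      · refine Finset.mem_union_right _ ?_
        simp only [Finset.mem_union, Finset.mem_Icc]
        omega
    · refine Finset.mem_union_left _ (Finset.mem_union_left _ (Finset.mem_filter.2 ⟨?_, h1⟩))
      rw [Finset.mem_Icc]
      push_cast
      exact hx
  have hcard := (Finset.card_le_card hsub).trans ((Finset.card_union_le _ _).trans
    (Nat.add_le_add ((Finset.card_union_le _ _).trans
      (Nat.add_le_add_left Finset.card_image_le _)) (Finset.card_union_le _ _)))
  simp only [Int.card_Icc] at hcard
  omega

theorem LocallyDense.mono {s : ℕ} {S S' : Finset ℤ} (h : LocallyDense s S) (hS : S ⊆ S') :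
    LocallyDense s S' := by
  obtain ⟨a, ha⟩ := h
  refine ⟨a, lt_of_le_of_lt (Nat.mul_le_mul_left _ (Finset.card_le_card fun x hx => ?_)) ha⟩
  rw [Finset.mem_filter] at hx ⊢
  exact ⟨hx.1, fun h => hx.2 (hS h)⟩

/-- One summand enlarges a set of subset sums by a constant factor, unless it is already
locally dense. -/
theorem exists_growth {D : Set ℕ} (hD : GcdOne D) {w κ : ℕ} (hw : ∀ x ∈ D, x ≤ w) (hw0 : 0 < w)
    (hκ : 0 < κ) {S : Finset ℤ} (hS : S.Nonempty) (h : ¬ LocallyDense (2 * κ * w) S) :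
    ∃ x ∈ D, (12 * κ * w + 1) * S.card ≤
      12 * κ * w * (withTranslate S (x : ℤ)).card := by
  obtain ⟨y, hy0, hy, hyS⟩ := exists_boundary_of_not_locallyDense (by positivity) h
  push_cast at hy
  by_contra! hc
  have hM : 0 < 12 * κ * w := by positivity
  have hpos := hS.card_pos
  have hδ : ∀ x ∈ D, boundary S (x : ℤ) ≤ (S.card - 1) / (12 * κ * w) := by
    intro x hx
    have := hc x hx
    rw [card_withTranslate, add_mul, mul_add] at this
    rw [Nat.le_div_iff_mul_le hM, mul_comm]
    omega
  have h1 := boundary_le_of_gcdOne hD hw hκ S hδ hy0 hy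
  have h2 := Nat.mul_div_le (S.card - 1) (12 * κ * w)
  have h3 : 4 * (3 * κ * w * ((S.card - 1) / (12 * κ * w))) =
    12 * κ * w * ((S.card - 1) / (12 * κ * w)) := by ring
  omega

theorem exists_locallyDense {ι : Type*} {D : ι → Set ℕ} (hD : ∀ i, GcdOne (D i)) {w κ : ℕ}
    (hw : ∀ i, ∀ x ∈ D i, x ≤ w) (hw0 : 0 < w) (hκ : 0 < κ) {r : ℕ}
    (hr : 12 * κ * w * r * w + 1 < 2 ^ r) (I : Finset ι) (hI : I.card = 12 * κ * w * r) :
    ∃ d : ι → ℕ, (∀ i ∈ I, d i ∈ D i) ∧ LocallyDense (2 * κ * w) (subsetSums ℤ d I) := by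
  have hM0 : 0 < 12 * κ * w := by positivity
  have hgr : ∀ i (S : Finset ℤ), S.Nonempty → ¬ LocallyDense (2 * κ * w) S → ∃ x ∈ D i,
      (12 * κ * w + 1) * S.card ≤ 12 * κ * w * (withTranslate S (x : ℤ)).card :=
    fun i S => exists_growth (hD i) (hw i) hw0 hκ
  generalize 12 * κ * w = M at *
  obtain ⟨d, hd, hΦ⟩ := exists_subsetSums_invariant D
    (fun n S => S.Nonempty ∧ (LocallyDense (2 * κ * w) S ∨ (M + 1) ^ n ≤ S.card * M ^ n))
    (by simp) (by
      rintro i n S ⟨hne, hS⟩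
      by_cases hl : LocallyDense (2 * κ * w) S
      · obtain ⟨x, hx, -⟩ := (hD i).exists_pos
        exact ⟨x, hx, hne.mono (subset_withTranslate _ _),
          Or.inl (hl.mono (subset_withTranslate _ _))⟩
      · obtain ⟨x, hx, hgrow⟩ := hgr i S hne hl
        refine ⟨x, hx, hne.mono (subset_withTranslate _ _), Or.inr ?_⟩
        have hn := hS.resolve_left hl
        calc (M + 1) ^ (n + 1) = (M + 1) * (M + 1) ^ n := by ring
          _ ≤ (M + 1) * (S.card * M ^ n) := Nat.mul_le_mul_left _ hn
          _ = (M + 1) * S.card * M ^ n := by ring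
          _ ≤ M * (withTranslate S (x : ℤ)).card * M ^ n := Nat.mul_le_mul_right _ hgrow
          _ = _ := by ring) I
  refine ⟨d, hd, hΦ.2.resolve_right fun hgrow => ?_⟩
  have hcard : (subsetSums ℤ d I).card ≤ M * r * w + 1 := by
    have hsub : subsetSums ℤ d I ⊆ Finset.Icc 0 (M * r * w : ℕ) := by
      intro y hy
      obtain ⟨T, hT, rfl⟩ := mem_subsetSums.1 hy
      have := sum_mem_bounds (w := w) (fun i hi => hw i _ (hd i hi)) hT
      rw [hI] at this
      simpa using this
    have := Finset.card_le_card hsub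
    rw [Int.card_Icc] at this
    omega
  have hbern : 2 * M ^ M ≤ (M + 1) ^ M := by
    have h := one_add_mul_le_pow (a := (1 / M : ℝ))
      (le_trans (by norm_num) (by positivity : (0 : ℝ) ≤ 1 / M)) M
    have hM' : (0 : ℝ) < M := by exact_mod_cast hM0
    have e : (1 + 1 / M : ℝ) = (M + 1) / M := by field_simp
    rw [mul_one_div_cancel hM'.ne', e, div_pow, le_div_iff₀ (by positivity)] at h
    norm_num at h
    exact_mod_cast h
  rw [hI, pow_mul, pow_mul M] at hgrow
  have h1 : 2 ^ r * (M ^ M) ^ r ≤ ((M + 1) ^ M) ^ r := by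
    rw [← mul_pow]
    exact Nat.pow_le_pow_left hbern r
  have h2 : 2 ^ r * (M ^ M) ^ r ≤ (M * r * w + 1) * (M ^ M) ^ r :=
    h1.trans (hgrow.trans (Nat.mul_le_mul_right _ hcard))
  have := Nat.le_of_mul_le_mul_right h2 (by positivity)
  omega

theorem exists_covers {ι : Type*} [Fintype ι] {D : ι → Set ℕ} (hD : ∀ i, GcdOne (D i)) {w κ : ℕ}
    (hw : ∀ i, ∀ x ∈ D i, x ≤ w) (hw0 : 0 < w) (hκ : 0 < κ) {r : ℕ}
    (hr : 12 * κ * w * r * w + 1 < 2 ^ r) (hι : 2 * (12 * κ * w * r) ≤ Fintype.card ι) :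
    ∃ d : ι → ℕ, (∀ i, d i ∈ D i) ∧ Covers d (κ * w) := by
  obtain ⟨I, -, hI⟩ := Finset.exists_subset_card_eq
    (show 12 * κ * w * r ≤ (Finset.univ : Finset ι).card by rw [Finset.card_univ]; omega)
  obtain ⟨I', hII', hI'⟩ := Finset.exists_subset_card_eq
    (show 12 * κ * w * r ≤ Iᶜ.card by rw [Finset.card_compl]; omega)
  have hdisj : ∀ i ∈ I', i ∉ I := fun i hi => Finset.mem_compl.1 (hII' hi)
  obtain ⟨d₁, hd₁, hl₁⟩ := exists_locallyDense hD hw hw0 hκ hr I hI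
  obtain ⟨d₂, hd₂, hl₂⟩ := exists_locallyDense hD hw hw0 hκ hr I' hI'
  choose e he using fun i => (hD i).exists_pos
  rw [mul_assoc] at hl₁ hl₂
  obtain ⟨x₀, hx₀⟩ := hl₁.exists_add hl₂
  refine ⟨fun i => if i ∈ I then d₁ i else if i ∈ I' then d₂ i else e i, fun i => ?_, x₀,
    fun z hz => ?_⟩
  · dsimp only
    split_ifs with h h'
    exacts [hd₁ i h, hd₂ i h', (he i).1]
  · obtain ⟨b, hb, b', hb', hbb⟩ := hx₀ z hz
    obtain ⟨T, hT, rfl⟩ := mem_subsetSums.1 hb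
    obtain ⟨T', hT', rfl⟩ := mem_subsetSums.1 hb'
    refine ⟨T ∪ T', ?_⟩
    rw [Finset.sum_union (Finset.disjoint_left.2 fun i hi hi' => hdisj i (hT' hi') (hT hi)), ← hbb]
    congr 1
    · exact Finset.sum_congr rfl fun i hi => by simp [hT hi]
    · exact Finset.sum_congr rfl fun i hi => by simp [hdisj i (hT' hi), hT' hi]

theorem growth_bound {κ L w : ℕ} (hκ : 0 < κ) (hL : 2 ≤ L) (hw : w < 2 ^ L) :
    12 * κ * w * (8 * κ * L) * w + 1 < 2 ^ (8 * κ * L) := by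
  have hκL : 2 ≤ κ * L := by nlinarith
  have h1 : w * w ≤ (2 ^ (κ * L)) ^ 2 := by
    have : 2 ^ L ≤ 2 ^ (κ * L) := Nat.pow_le_pow_right (by norm_num) (by nlinarith)
    rw [sq]
    exact Nat.mul_le_mul (by omega) (by omega)
  have e : 2 ^ (8 * κ * L) = (2 ^ (κ * L)) ^ 2 * (2 ^ (κ * L)) ^ 6 := by
    rw [← pow_mul, ← pow_mul, ← pow_add]
    congr 1
    ring
  have hu : κ * L + 1 ≤ 2 ^ (κ * L) := Nat.lt_two_pow_self
  generalize 2 ^ (κ * L) = u at *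
  have hu3 : 3 ≤ u := by omega
  have h2 : 96 * κ * κ * L + 1 ≤ u ^ 6 := by
    have h4 : (κ * L + 1) ^ 2 ≤ u ^ 2 := Nat.pow_le_pow_left hu 2
    have h5 : 3 ^ 4 ≤ u ^ 4 := Nat.pow_le_pow_left hu3 4
    have h6 : u ^ 6 = u ^ 4 * u ^ 2 := by ring
    rw [h6]
    have h7 : 3 ^ 4 * (κ * L + 1) ^ 2 ≤ u ^ 4 * u ^ 2 := Nat.mul_le_mul h5 h4
    have h8 : κ * κ * L * 2 ≤ κ * κ * L * L := Nat.mul_le_mul_left _ hL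
    nlinarith
  have hu2 : 1 < u ^ 2 := by nlinarith
  rw [e]
  calc 12 * κ * w * (8 * κ * L) * w + 1 = (w * w) * (96 * κ * κ * L) + 1 := by ring
    _ ≤ u ^ 2 * (96 * κ * κ * L) + 1 := by gcongr
    _ < u ^ 2 * (96 * κ * κ * L + 1) := by rw [mul_add]; omega
    _ ≤ _ := Nat.mul_le_mul_left _ h2

/-! ### Colourings and shifts -/

/-- Colourings with colours `0, …, k-1` whose values on adjacent vertices are related by `R`. -/
def RelCol {V : Type} (R : ℕ → ℕ → Prop) (G : SimpleGraph V) (k : ℕ) (C : V → ℕ) : Prop :=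
  (∀ v, C v < k) ∧ ∀ ⦃u v⦄, G.Adj u v → R (C u) (C v)

/-- The common form of proper and topological flexi-chromaticity. -/
def RelFlexi {V : Type} (R : ℕ → ℕ → Prop) (H : SimpleGraph V) (k s : ℕ) : Prop :=
  ∃ φ, RelCol R H k φ ∧ ∀ w : Fin k → ℤ, ∑ i, w i = 0 → (∀ i, |w i| ≤ (s : ℤ)) →
    ∃ φ', RelCol R H k φ' ∧
      ∀ i : Fin k, ({v | φ v = i}.ncard : ℤ) - {v | φ' v = i}.ncard = w i

/-- There are two colourings whose class sizes differ by moving `d` vertices from colour `0` to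
colour `j`. -/
def HasShift {V : Type} (R : ℕ → ℕ → Prop) (G : SimpleGraph V) (k j d : ℕ) : Prop :=
  ∃ C C' : V → ℕ, RelCol R G k C ∧ RelCol R G k C' ∧ ∀ i : ℕ,
    ({v | C' v = i}.ncard : ℤ) =
      {v | C v = i}.ncard + ((if i = j then 1 else 0) - (if i = 0 then 1 else 0)) * d

theorem ncard_class_eq_sum {V : Type} [Fintype V] (C : V → ℕ) (i : ℕ) :
    ({v | C v = i}.ncard : ℤ) = ∑ v, if C v = i then 1 else 0 := by
  rw [Set.ncard_eq_toFinset_card', Finset.sum_boole]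
  simp

theorem HasShift.of_iso {V W : Type} {R : ℕ → ℕ → Prop} {F : SimpleGraph V} {F' : SimpleGraph W}
    (e : F ≃g F') {k j d : ℕ} (h : HasShift R F' k j d) : HasShift R F k j d := by
  obtain ⟨C, C', hC, hC', hcnt⟩ := h
  have key : ∀ (C : W → ℕ) (i : ℕ), {v | (C ∘ e) v = i}.ncard = {v | C v = i}.ncard := by
    intro C i
    exact Set.ncard_preimage_of_injective_subset_range (s := {v | C v = i}) e.injective
      (by rw [e.surjective.range_eq]; exact Set.subset_univ _)
  refine ⟨C ∘ e, C' ∘ e, ⟨fun v => hC.1 _, fun u v h => hC.2 (e.map_adj_iff.2 h)⟩,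
    ⟨fun v => hC'.1 _, fun u v h => hC'.2 (e.map_adj_iff.2 h)⟩, fun i => ?_⟩
  rw [key, key]
  exact hcnt i

theorem HasShift.ne_of_mem_DSet {V : Type} [Fintype V] {F : SimpleGraph V} {k j d : ℕ}
    (hF : F.Colorable k) (hj : j ≠ 0) (hjk : j < k)
    (hd : d ∈ DSet F) : HasShift (· ≠ ·) F k j d := by
  obtain ⟨C, hC, rfl⟩ := hd
  have hle : chromNum F ≤ k := ENat.toNat_le_of_le_natCast hF.chromaticNumber_le
  have hperm : ∀ σ : Equiv.Perm ℕ, (∀ x < k, σ x < k) → RelCol (· ≠ ·) F k (σ ∘ C) :=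
    fun σ hσ => ⟨fun v => hσ _ ((hC.1 v).trans_le hle),
      fun u v h he => hC.2 h (σ.injective he)⟩
  have hswap : ∀ a b : ℕ, a < k → b < k → ∀ x < k, Equiv.swap a b x < k := by
    intro a b ha hb x hx
    rw [Equiv.swap_apply_def]
    split_ifs <;> assumption
  have hcnt : ∀ (σ : Equiv.Perm ℕ) (i : ℕ), {v | (σ ∘ C) v = i}.ncard = classCard C (σ.symm i) := by
    intro σ i
    simp [classCard, Equiv.eq_symm_apply]
  have hk0 : 0 < k := by omega
  have hk1 : 1 < k := by omega
  set σ := Equiv.swap 1 j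
  set τ := (Equiv.swap 1 j).trans (Equiv.swap 0 j)
  have hσ : ∀ x < k, σ x < k := hswap 1 j hk1 hjk
  have hτ : ∀ x < k, τ x < k := fun x hx => hswap 0 j hk0 hjk _ (hσ x hx)
  have hσ0 : σ.symm 0 = 0 := by
    simp only [σ, Equiv.symm_swap]
    exact Equiv.swap_apply_of_ne_of_ne (by omega) (by omega)
  have hσj : σ.symm j = 1 := by simp [σ]
  have hτ0 : τ.symm 0 = 1 := by simp [τ]
  have hτj : τ.symm j = 0 := by
    simp only [τ, Equiv.symm_trans_apply, Equiv.symm_swap, Equiv.swap_apply_right]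
    exact Equiv.swap_apply_of_ne_of_ne (by omega) (by omega)
  have hτi : ∀ i, i ≠ 0 → i ≠ j → τ.symm i = σ.symm i := by
    intro i hi hij
    simp only [τ, σ, Equiv.symm_trans_apply, Equiv.symm_swap]
    rw [Equiv.swap_apply_of_ne_of_ne hi hij]
  rcases le_total (classCard C 1) (classCard C 0) with h | h
  · refine ⟨σ ∘ C, τ ∘ C, hperm σ hσ, hperm τ hτ, fun i => ?_⟩
    rw [hcnt, hcnt]
    by_cases hi0 : i = 0
    · subst hi0
      rw [hσ0, hτ0, if_neg hj.symm, if_pos rfl]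
      omega
    · by_cases hij : i = j
      · subst hij
        rw [hσj, hτj, if_pos rfl, if_neg hi0]
        omega
      · rw [hτi i hi0 hij, if_neg hi0, if_neg hij]
        omega
  · refine ⟨τ ∘ C, σ ∘ C, hperm τ hτ, hperm σ hσ, fun i => ?_⟩
    rw [hcnt, hcnt]
    by_cases hi0 : i = 0
    · subst hi0
      rw [hσ0, hτ0, if_neg hj.symm, if_pos rfl]
      omega
    · by_cases hij : i = j
      · subst hij
        rw [hσj, hτj, if_pos rfl, if_neg hi0]
        omega
      · rw [hτi i hi0 hij, if_neg hi0, if_neg hij]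
        omega

theorem HasShift.eq_of_mem_compOrders {V : Type} [Fintype V] {F : SimpleGraph V} {k j d : ℕ}
    (hjk : j < k) (hd : d ∈ compOrders F) : HasShift (· = ·) F k j d := by
  obtain ⟨c, rfl⟩ := hd
  refine ⟨fun _ => 0, fun v => if v ∈ c.supp then j else 0, ⟨fun _ => Nat.zero_lt_of_lt hjk, fun _ _ _ => rfl⟩,
    ⟨fun v => by dsimp only; split_ifs <;> omega, fun u v h => ?_⟩, fun i => ?_⟩
  · have : u ∈ c.supp ↔ v ∈ c.supp := c.mem_supp_congr_adj h
    simp only [this]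
  · have hs : (c.supp.ncard : ℤ) = ∑ v, if v ∈ c.supp then 1 else 0 := by
      rw [Set.ncard_eq_toFinset_card', Finset.sum_boole]
      congr 2
      ext v
      simp
    rw [ncard_class_eq_sum, ncard_class_eq_sum, hs, Finset.mul_sum, ← Finset.sum_add_distrib]
    refine Finset.sum_congr rfl fun v _ => ?_
    by_cases hv : v ∈ c.supp <;> by_cases hi0 : i = 0 <;> by_cases hij : i = j <;>
      simp [hv, hi0, hij, eq_comm] <;> omega

theorem le_card_of_mem_DSet {V : Type} [Fintype V] {F : SimpleGraph V} {d : ℕ} (hd : d ∈ DSet F) :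
    d ≤ Fintype.card V := by
  obtain ⟨C, -, rfl⟩ := hd
  have h : ∀ i, classCard C i ≤ Fintype.card V := fun i => by
    rw [← Nat.card_eq_fintype_card]
    exact Set.ncard_le_card _
  have h0 := h 0
  have h1 := h 1
  omega

theorem le_card_of_mem_compOrders {V : Type} [Fintype V] {F : SimpleGraph V} {d : ℕ}
    (hd : d ∈ compOrders F) : d ≤ Fintype.card V := by
  obtain ⟨c, rfl⟩ := hd
  rw [← Nat.card_eq_fintype_card]
  exact Set.ncard_le_card _

/-- A union of tiles admitting enough shifts from colour `0` to every other colour is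
flexi-chromatic. -/
theorem relFlexi_iUnion {V : Type} [Fintype V] {H : SimpleGraph V} {R : ℕ → ℕ → Prop}
    {l n s : ℕ} (p : Fin l × Fin n → Set V) (hdisj : Pairwise (Function.onFun Disjoint p))
    (hadj : ∀ a b, a ≠ b → ∀ u ∈ p a, ∀ v ∈ p b, ¬ H.Adj u v) (d : Fin l → Fin n → ℕ)
    (hsh : ∀ j a, HasShift R (H.induce (p (j, a))) (l + 1) (j + 1) (d j a))
    (hcov : ∀ j, Covers (d j) s) : RelFlexi R (H.induce (⋃ i, p i)) (l + 1) s := by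
  choose C C' hC hC' hcnt using fun i : Fin l × Fin n => hsh i.1 i.2
  let e := Set.unionEqSigmaOfDisjoint hdisj
  have he : ∀ v, ((e v).2 : V) = v := Set.coe_snd_unionEqSigmaOfDisjoint hdisj
  let ψ : (Fin l → Finset (Fin n)) → (Σ i, p i) → ℕ := fun T x =>
    if x.1.2 ∈ T x.1.1 then C' x.1 x.2 else C x.1 x.2
  have hcol : ∀ T, RelCol R (H.induce (⋃ i, p i)) (l + 1) (ψ T ∘ e) := by
    intro T
    refine ⟨fun v => ?_, fun u v huv => ?_⟩
    · simp only [ψ, Function.comp]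
      split_ifs
      exacts [(hC' _).1 _, (hC _).1 _]
    · have hu := he u
      have hv := he v
      simp only [Function.comp]
      replace huv : H.Adj u v := huv
      rw [← hu, ← hv] at huv
      generalize e u = x at *
      generalize e v = y at *
      obtain ⟨i, x⟩ := x
      obtain ⟨i', y⟩ := y
      obtain rfl : i = i' := by
        by_contra hne
        exact hadj i i' hne x x.2 y y.2 huv
      simp only [ψ]
      split_ifs
      exacts [(hC' i).2 huv, (hC i).2 huv]
  have hcount : ∀ (T : Fin l → Finset (Fin n)) (x : ℕ), ({v | (ψ T ∘ e) v = x}.ncard : ℤ) =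
      ∑ i, ({u | C i u = x}.ncard : ℤ) + ∑ j : Fin l,
        ((if x = j + 1 then 1 else 0) - (if x = 0 then 1 else 0)) * ∑ a ∈ T j, (d j a : ℤ) := by
    intro T x
    rw [ncard_class_eq_sum]
    simp only [Function.comp]
    rw [Equiv.sum_comp e (fun y => if ψ T y = x then (1 : ℤ) else 0), Fintype.sum_sigma]
    have hi : ∀ i : Fin l × Fin n, (∑ u : p i, if ψ T ⟨i, u⟩ = x then (1 : ℤ) else 0) =
        {u | C i u = x}.ncard + ((if x = i.1 + 1 then 1 else 0) - (if x = 0 then 1 else 0)) *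
          (if i.2 ∈ T i.1 then (d i.1 i.2 : ℤ) else 0) := by
      intro i
      by_cases h : i.2 ∈ T i.1
      · simp only [ψ, h, if_true]
        rw [← ncard_class_eq_sum, hcnt]
      · simp only [ψ, h, if_false]
        rw [← ncard_class_eq_sum, mul_zero, add_zero]
    rw [Finset.sum_congr rfl fun i _ => hi i, Finset.sum_add_distrib]
    congr 1
    rw [Fintype.sum_prod_type]
    refine Finset.sum_congr rfl fun j _ => ?_
    have hT : ∑ a ∈ T j, (d j a : ℤ) = ∑ a, if a ∈ T j then (d j a : ℤ) else 0 := by simp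
    rw [hT, Finset.mul_sum]
  choose x₀ hx₀ using hcov
  have hT₀ := fun j => hx₀ j 0 (by simp)
  choose T₀ hT₀ using hT₀
  refine ⟨ψ T₀ ∘ e, hcol _, fun w hw hws => ?_⟩
  have hT := fun j : Fin l => hx₀ j (-w j.succ) (by rw [abs_neg]; exact hws _)
  choose T hT using hT
  refine ⟨ψ T ∘ e, hcol _, fun i => ?_⟩
  rw [hcount, hcount, add_sub_add_left_eq_sub, ← Finset.sum_sub_distrib]
  have hterm : ∀ j : Fin l, ((if (i : ℕ) = j + 1 then 1 else 0) - (if (i : ℕ) = 0 then 1 else 0)) *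
      ∑ a ∈ T₀ j, (d j a : ℤ) - ((if (i : ℕ) = j + 1 then 1 else 0) -
        (if (i : ℕ) = 0 then 1 else 0)) * ∑ a ∈ T j, (d j a : ℤ) =
      (if (i : ℕ) = j + 1 then w j.succ else 0) - (if (i : ℕ) = 0 then w j.succ else 0) := by
    intro j
    rw [hT₀, hT]
    split_ifs <;> ring
  rw [Finset.sum_congr rfl fun j _ => hterm j]
  rw [Fin.sum_univ_succ] at hw
  refine Fin.cases ?_ (fun i => ?_) i
  · simp
    linarith
  · simp [Fin.val_inj]

theorem compClosed_of_tiles {V : Type} {H : SimpleGraph V} {P : Set (Set V)}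
    (hP : Setoid.IsPartition P)
    (hadj : ∀ p ∈ P, ∀ q ∈ P, p ≠ q → ∀ u ∈ p, ∀ v ∈ q, ¬ H.Adj u v) {p : Set V} (hp : p ∈ P) :
    CompClosed H p := by
  rintro u v ⟨W⟩ hu
  induction W with
  | nil => exact hu
  | @cons u x v h _ ih =>
    obtain ⟨q, ⟨hq, hxq⟩, -⟩ := hP.2 x
    refine ih ?_
    by_cases hpq : p = q
    · exact hpq ▸ hxq
    · exact absurd h (hadj p hp q hq hpq u hu x hxq)

theorem compClosed_iUnion {V ι : Type} {H : SimpleGraph V} {p : ι → Set V}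
    (h : ∀ i, CompClosed H (p i)) : CompClosed H (⋃ i, p i) := by
  intro u v huv hu
  obtain ⟨i, hi⟩ := Set.mem_iUnion.1 hu
  exact Set.mem_iUnion.2 ⟨i, h i huv hi⟩

theorem ncard_iUnion_le_mul {V ι : Type} [Fintype V] [Fintype ι] {w : ℕ} (p : ι → Set V)
    (h : ∀ i, (p i).ncard ≤ w) : (⋃ i, p i).ncard ≤ Fintype.card ι * w := by
  have h1 := Set.ncard_iUnion_le_of_fintype p
  have h2 := Finset.sum_le_card_nsmul Finset.univ (fun i => (p i).ncard) w fun i _ => h i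
  simpa using h1.trans h2

theorem hasFlexiSubtilings_of_covers {V : Type} [Fintype V] {H : SimpleGraph V} {P : Set (Set V)}
    (hP : Setoid.IsPartition P)
    (hadj : ∀ p ∈ P, ∀ q ∈ P, p ≠ q → ∀ u ∈ p, ∀ v ∈ q, ¬ H.Adj u v) {w : ℕ} (hw0 : 0 < w)
    (hw : ∀ p ∈ P, p.ncard ≤ w) {t k ℓ s s' w' n n' : ℕ} (hn : k * n * w ≤ w')
    (hn' : ℓ * n' * w ≤ w') (hcard : (t + 1) * w' ≤ Fintype.card V)
    (h : ∀ j : Fin k, ∀ σ : Fin n → P, ∃ d : Fin n → ℕ,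
      (∀ a, HasShift (· ≠ ·) (H.induce (σ a : Set V)) (k + 1) (j + 1) (d a)) ∧ Covers d s)
    (h' : ∀ j : Fin ℓ, ∀ σ : Fin n' → P, ∃ d : Fin n' → ℕ,
      (∀ a, HasShift (· = ·) (H.induce (σ a : Set V)) (ℓ + 1) (j + 1) (d a)) ∧ Covers d s') :
    HasFlexiSubtilings H t (ℓ + 1) (k + 1) s s' w' := by
  have hPcard : Fintype.card V ≤ Fintype.card P * w := by
    have := ncard_iUnion_le_mul (fun p : P => (p : Set V)) fun p => hw p p.2
    rwa [← Set.sUnion_eq_iUnion, hP.sUnion_eq_univ, Set.ncard_univ, Nat.card_eq_fintype_card] at this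
  have hJ : Fintype.card (Fin t × Fin k × Fin n ⊕ Fin ℓ × Fin n') ≤ Fintype.card P := by
    refine Nat.le_of_mul_le_mul_right (le_trans ?_ (hcard.trans hPcard)) hw0
    simp only [Fintype.card_sum, Fintype.card_prod, Fintype.card_fin]
    calc (t * (k * n) + ℓ * n') * w = t * (k * n * w) + ℓ * n' * w := by ring
      _ ≤ t * w' + w' := Nat.add_le_add (Nat.mul_le_mul_left _ hn) hn'
      _ = _ := by ring
  obtain ⟨f⟩ := Function.Embedding.nonempty_of_card_le hJ
  have hne : ∀ {x y}, x ≠ y → (f x : Set V) ≠ f y := fun hxy he =>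
    hxy (f.injective (Subtype.ext he))
  have hdisj : ∀ {x y}, x ≠ y → Disjoint (f x : Set V) (f y) := fun {x y} hxy =>
    hP.pairwiseDisjoint (f x).2 (f y).2 (hne hxy)
  have hadj' : ∀ {x y}, x ≠ y → ∀ u ∈ (f x : Set V), ∀ v ∈ (f y : Set V), ¬ H.Adj u v :=
    fun {x y} hxy => hadj _ (f x).2 _ (f y).2 (hne hxy)
  refine ⟨fun i => ⋃ x : Fin k × Fin n, (f (Sum.inl (i, x)) : Set V),
    ⋃ x : Fin ℓ × Fin n', (f (Sum.inr x) : Set V), fun i => ?_, ?_, fun i j hij => ?_,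
    fun i => ?_, fun i => ?_, ?_, fun i => ?_, ?_⟩
  · exact compClosed_iUnion fun x => compClosed_of_tiles hP hadj (f _).2
  · exact compClosed_iUnion fun x => compClosed_of_tiles hP hadj (f _).2
  · simp only [Set.disjoint_iUnion_left, Set.disjoint_iUnion_right]
    exact fun x y => hdisj (by simp [hij])
  · simp only [Set.disjoint_iUnion_left, Set.disjoint_iUnion_right]
    exact fun x y => hdisj (by simp)
  · refine (ncard_iUnion_le_mul _ fun x => hw _ (f _).2).trans ?_
    simpa using hn
  · refine (ncard_iUnion_le_mul _ fun x => hw _ (f _).2).trans ?_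
    simpa using hn'
  · choose d hd hcov using fun j : Fin k => h j fun a => f (Sum.inl (i, j, a))
    exact relFlexi_iUnion (fun x : Fin k × Fin n => (f (Sum.inl (i, x)) : Set V))
      (fun x y hxy => hdisj (by simpa using hxy)) (fun x y hxy => hadj' (by simpa using hxy)) d
      (fun j a => hd j a) hcov
  · choose d hd hcov using fun j : Fin ℓ => h' j fun a => f (Sum.inr (j, a))
    exact relFlexi_iUnion (fun x : Fin ℓ × Fin n' => (f (Sum.inr x) : Set V))
      (fun x y hxy => hdisj (by simpa using hxy)) (fun x y hxy => hadj' (by simpa using hxy)) d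
      (fun j a => hd j a) hcov

/-! ### The main result -/

theorem IsFcr.two_le {V : Type} [Fintype V] {F : SimpleGraph V} (h : IsFcr F) :
    2 ≤ F.chromaticNumber := by
  rcases h with h | h
  · exact h.1.ge
  · exact le_trans (by norm_num) h.1

theorem IsFcr.gcdOne_DSet {V : Type} [Fintype V] {F : SimpleGraph V} (h : IsFcr F) :
    GcdOne (DSet F) := by
  rcases h with h | h
  exacts [h.2.1, h.2]

theorem IsFcr.gcdOne_compOrders {V : Type} [Fintype V] {F : SimpleGraph V} (h : IsFcr F)
    (hF : F.Colorable 2) : GcdOne (compOrders F) := by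
  rcases h with h | h
  · exact h.2.2
  · have := h.1.trans hF.chromaticNumber_le
    norm_num at this

theorem IsFcr.two_le_card {V : Type} [Fintype V] {F : SimpleGraph V} (h : IsFcr F) :
    2 ≤ Fintype.card V := by
  have := h.two_le.trans F.colorable_of_fintype.chromaticNumber_le
  exact_mod_cast this

theorem natLog_add_one_le {w : ℕ} (hw : 2 ≤ w) : ((Nat.log 2 w + 1 : ℕ) : ℝ) ≤ 4 * Real.log w := by
  have h1 : (Nat.log 2 w : ℝ) ≤ Real.log w / Real.log 2 := by
    simpa [Real.logb] using Real.natLog_le_logb w 2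
  have h2 := Real.log_two_gt_d9
  have h3 : Real.log 2 ≤ Real.log w := Real.log_le_log (by norm_num) (by exact_mod_cast hw)
  have h4 : Real.log w / Real.log 2 ≤ 2 * Real.log w := by
    rw [div_le_iff₀ (by linarith)]
    nlinarith
  push_cast
  linarith

theorem mixed_tiles_bound {g κ N w w' : ℕ} (hg : g ≤ N) (hκ : κ ≤ N) (hN : 3 ≤ N) (hw : 2 ≤ w)
    (h : (N : ℝ) ^ 10 * (w : ℝ) ^ 2 * Real.log w ≤ w') :
    g * (2 * (12 * κ * w * (8 * κ * (Nat.log 2 w + 1)))) * w ≤ w' := by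
  have h1 := natLog_add_one_le hw
  have hlog : 0 ≤ Real.log w := Real.log_natCast_nonneg w
  generalize Nat.log 2 w + 1 = L at *
  have h2 : g * (κ * κ) ≤ N * (N * N) := Nat.mul_le_mul hg (Nat.mul_le_mul hκ hκ)
  have h3 : 768 * (N * (N * N)) ≤ N ^ 10 := by
    have : 3 ^ 7 ≤ N ^ 7 := Nat.pow_le_pow_left hN 7
    calc 768 * (N * (N * N)) ≤ N ^ 7 * (N * (N * N)) := Nat.mul_le_mul_right _ (by omega)
      _ = N ^ 10 := by ring
  have h4 : 768 * ((g : ℝ) * (κ * κ)) ≤ (N : ℝ) ^ 10 := by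
    exact_mod_cast (Nat.mul_le_mul_left _ h2).trans h3
  have h5 : ((g * (2 * (12 * κ * w * (8 * κ * L))) * w : ℕ) : ℝ) ≤ w' := by
    push_cast
    calc (g : ℝ) * (2 * (12 * κ * w * (8 * κ * L))) * w
        = 192 * (g * (κ * κ)) * w ^ 2 * L := by ring
      _ ≤ 192 * (g * (κ * κ)) * w ^ 2 * (4 * Real.log w) := by gcongr
      _ = 768 * (g * (κ * κ)) * w ^ 2 * Real.log w := by ring
      _ ≤ (N : ℝ) ^ 10 * w ^ 2 * Real.log w := by gcongr
      _ ≤ w' := h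
  exact_mod_cast h5

theorem const_tiles_bound {g κ N w w' : ℕ} (hg : g ≤ N) (hκ : κ ≤ N) (hN : 3 ≤ N)
    (h : (N : ℝ) ^ 10 * (w : ℝ) ^ 2 ≤ w') : g * (4 * κ * w) * w ≤ w' := by
  have h0 : N ^ 10 * w ^ 2 ≤ w' := by exact_mod_cast h
  have h3 : 4 * (N * N) ≤ N ^ 10 := by
    have : 3 ^ 8 ≤ N ^ 8 := Nat.pow_le_pow_left hN 8
    calc 4 * (N * N) ≤ N ^ 8 * (N * N) := Nat.mul_le_mul_right _ (by omega)
      _ = N ^ 10 := by ring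
  calc g * (4 * κ * w) * w = 4 * (g * κ) * w ^ 2 := by ring
    _ ≤ 4 * (N * N) * w ^ 2 :=
      Nat.mul_le_mul_right _ (Nat.mul_le_mul_left _ (Nat.mul_le_mul hg hκ))
    _ ≤ N ^ 10 * w ^ 2 := Nat.mul_le_mul_right _ h3
    _ ≤ w' := h0

/-- Lemma 2.2 (`𝓕_cr`-tilings contain flexi-chromatic subtilings). -/
theorem hcf_gives_flexi_chrom_mixed (n w w' t Δ : ℕ) (hn : 0 < n) (hw : 0 < w)
    (hw' : 0 < w') (ht : 0 < t) (hΔ : 0 < Δ) (χ : ℝ) (hχ : 1 < χ) (ℓ : ℕ)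
    (hℓ : ℓ = if ⌈χ⌉₊ = 2 then t else 1)
    (m : ℕ) (H : SimpleGraph (Fin m)) (hm : m ≤ n)
    (hB : IsTiling H (TileLe w)) (hΔH : ∀ v, ndeg H v ≤ Δ) (hcrit : critR H ≤ χ)
    (hcase :
      (IsTiling H (TileFcr ⌈χ⌉₊ (w : ℝ)) ∧
        (((⌈χ⌉₊ + ℓ : ℕ) : ℝ) ^ 10 * (w : ℝ) ^ 2 * Real.log w ≤ (w' : ℝ))) ∨
      ((∃ m₀ : ℕ, ∃ F₀ : SimpleGraph (Fin m₀), m₀ ≤ w ∧ IsFcr F₀ ∧ F₀.Colorable ⌈χ⌉₊ ∧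
          IsTiling H (TileIso F₀)) ∧
        (((⌈χ⌉₊ + ℓ : ℕ) : ℝ) ^ 10 * (w : ℝ) ^ 2 ≤ (w' : ℝ))))
    (hv : (t + ℓ) * w' ≤ m) :
    HasFlexiSubtilings H t ℓ ⌈χ⌉₊ (⌈χ⌉₊ * w) w w' := by
  obtain ⟨k, hk⟩ : ∃ k, ⌈χ⌉₊ = k + 1 := ⟨⌈χ⌉₊ - 1, by have := Nat.ceil_pos.2 (by linarith : 0 < χ); omega⟩
  have hk1 : 1 ≤ k := by
    have : 1 < ⌈χ⌉₊ := Nat.lt_ceil.2 (by simpa using hχ)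
    omega
  obtain ⟨l, rfl⟩ : ∃ l, ℓ = l + 1 := ⟨ℓ - 1, by split_ifs at hℓ <;> omega⟩
  have hl : 0 < l → k + 1 = 2 := by
    intro hl
    by_contra hne
    rw [hk, if_neg hne] at hℓ
    omega
  have hm0 : 0 < m := lt_of_lt_of_le (by positivity) hv
  have hcard : (t + 1) * w' ≤ Fintype.card (Fin m) := by
    rw [Fintype.card_fin]
    exact (Nat.mul_le_mul_right _ (by omega)).trans hv
  rw [hk] at hcase ⊢
  have hN : 3 ≤ k + 1 + (l + 1) := by omega
  rcases hcase with ⟨⟨P, hP, hadj, htile⟩, hbound⟩ | ⟨⟨m₀, F₀, hm₀, hF₀, hcol₀, P, hP, hadj, htile⟩, hbound⟩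
  · have hfcr : ∀ p : P, IsFcr (H.induce (p : Set (Fin m))) := fun p => (htile p p.2).1
    have hcol : ∀ p : P, (H.induce (p : Set (Fin m))).Colorable (k + 1) :=
      fun p => (htile p p.2).2.1
    have hcw : ∀ p : P, Fintype.card (p : Set (Fin m)) ≤ w := fun p => by
      exact_mod_cast (htile p p.2).2.2
    have hw2 : 2 ≤ w := by
      obtain ⟨p, ⟨hp, -⟩, -⟩ := hP.2 ⟨0, hm0⟩
      exact (hfcr ⟨p, hp⟩).two_le_card.trans (hcw ⟨p, hp⟩)
    have hL : 2 ≤ Nat.log 2 w + 1 := by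
      have := Nat.log_pos (b := 2) (by norm_num) hw2
      omega
    have hwL : w < 2 ^ (Nat.log 2 w + 1) := Nat.lt_pow_succ_log_self (by norm_num) w
    refine hasFlexiSubtilings_of_covers hP hadj hw ?_
      (mixed_tiles_bound (g := k) (κ := k + 1) (by omega) (by omega) hN hw2 hbound)
      (mixed_tiles_bound (g := l) (κ := 1) (by omega) (by omega) hN hw2 hbound) hcard ?_ ?_
    · intro p hp
      rw [← Nat.card_coe_set_eq, Nat.card_eq_fintype_card]
      exact hcw ⟨p, hp⟩
    · intro j σ
      obtain ⟨d, hd, hc⟩ := exists_covers (D := fun a => DSet (H.induce (σ a : Set (Fin m))))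
        (fun a => (hfcr _).gcdOne_DSet) (fun a x hx => (le_card_of_mem_DSet hx).trans (hcw _)) hw
        k.succ_pos (growth_bound k.succ_pos hL hwL) (Fintype.card_fin _).ge
      exact ⟨d, fun a => HasShift.ne_of_mem_DSet (hcol _) (by omega) (by omega)
        (hd a), hc⟩
    · intro j σ
      have hk2 := hl (by have := j.2; omega)
      obtain ⟨d, hd, hc⟩ := exists_covers (D := fun a => compOrders (H.induce (σ a : Set (Fin m))))
        (fun a => (hfcr _).gcdOne_compOrders (hk2 ▸ hcol _))
        (fun a x hx => (le_card_of_mem_compOrders hx).trans (hcw _)) hw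
        one_pos (growth_bound one_pos hL hwL) (Fintype.card_fin _).ge
      exact ⟨d, fun a => HasShift.eq_of_mem_compOrders (by omega) (hd a),
        by rwa [one_mul] at hc⟩
  · refine hasFlexiSubtilings_of_covers hP hadj hw ?_
      (const_tiles_bound (g := k) (κ := k + 1) (by omega) (by omega) hN hbound)
      (const_tiles_bound (g := l) (κ := 1) (by omega) (by omega) hN hbound) hcard ?_ ?_
    · intro p hp
      obtain ⟨e⟩ := htile p hp
      rw [← Nat.card_coe_set_eq, Nat.card_congr e.toEquiv, Nat.card_fin]
      exact hm₀
    · intro j σ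
      obtain ⟨d, hd, hc⟩ := exists_covers_of_const hF₀.gcdOne_DSet
        (fun x hx => (le_card_of_mem_DSet hx).trans (by simpa using hm₀)) k.succ_pos
        (Fintype.card_fin _).ge
      refine ⟨d, fun a => ?_, hc⟩
      obtain ⟨e⟩ := htile _ (σ a).2
      exact (HasShift.ne_of_mem_DSet hcol₀ (by omega) (by omega) (hd a)).of_iso e
    · intro j σ
      have hk2 := hl (by have := j.2; omega)
      obtain ⟨d, hd, hc⟩ := exists_covers_of_const (hF₀.gcdOne_compOrders (hk2 ▸ hcol₀))
        (fun x hx => (le_card_of_mem_compOrders hx).trans (by simpa using hm₀)) one_pos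
        (Fintype.card_fin _).ge
      refine ⟨d, fun a => ?_, by rwa [one_mul] at hc⟩
      obtain ⟨e⟩ := htile _ (σ a).2
      exact (HasShift.eq_of_mem_compOrders (by omega) (hd a)).of_iso e

end Paper
end

section
/- Let χ ≥ 1 and let F be a graph with at least one edge satisfying crit(F) ≤ χ. Let G be a graph on n vertices with minimum degree δ(G) ≥ (1 − 1/χ)n. Then G has a perfect fractional F-tiling. -/
open scoped Classical

namespace Paper

/-- A Farkas-type alternative for points of an affine hyperplane not through the origin. -/
theorem exists_mem_stdSimplex_sum_eq {ι W : Type*} [Fintype ι] [Fintype W] (z : ι → W → ℝ)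
    (x : W → ℝ) (hz : ∀ i, ∑ w, z i w = 1) (hx : ∑ w, x w = 1)
    (h : ∀ y : W → ℝ, (∀ i, 0 < ∑ w, y w * z i w) → 0 ≤ ∑ w, y w * x w) :
    ∃ p ∈ stdSimplex ℝ ι, ∀ w, ∑ i, p i * z i w = x w := by
  let L : (ι → ℝ) →ₗ[ℝ] (W → ℝ) := Fintype.linearCombination ℝ z
  have hL : Continuous L := L.continuous_of_finiteDimensional
  by_contra hcon
  have hxK : x ∉ L '' stdSimplex ℝ ι := by
    rintro ⟨p, hp, rfl⟩
    exact hcon ⟨p, hp, fun w => by simp [L, Fintype.linearCombination_apply]⟩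
  obtain ⟨f, s, hfx, hf⟩ := geometric_hahn_banach_point_closed
    ((convex_stdSimplex ℝ ι).linear_image L) ((isCompact_stdSimplex ℝ ι).image hL).isClosed hxK
  have hrep : ∀ v : W → ℝ, f v = ∑ w, f (Pi.single w 1) * v w := fun v => by
    conv_lhs => rw [pi_eq_sum_univ' v, map_sum]
    refine Finset.sum_congr rfl fun w _ => ?_
    rw [map_smul, smul_eq_mul, mul_comm]
  have hshift : ∀ v : W → ℝ, ∑ w, v w = 1 →
      ∑ w, (f (Pi.single w 1) - s) * v w = f v - s := fun v hv => by
    simp only [sub_mul, Finset.sum_sub_distrib, ← Finset.mul_sum, hv, ← hrep, mul_one]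
  have := h (fun w => f (Pi.single w 1) - s) fun i => by
    rw [hshift _ (hz i)]
    have hmem : z i ∈ L '' stdSimplex ℝ ι :=
      ⟨Pi.single i 1, single_mem_stdSimplex ℝ i, by
        simp [L, Fintype.linearCombination_apply_single]⟩
    linarith [hf _ hmem]
  rw [hshift _ hx] at this
  linarith

/-- Choosing greedily the vertex of smallest weight yields a clique of small weights. -/
theorem exists_greedy_clique_s7 {W : Type} [Fintype W] (G : SimpleGraph W) (y : W → ℝ) (r : ℝ)
    (hr : 0 ≤ r) (hdeg : ∀ v, (Fintype.card W : ℝ) - r ≤ (ndeg G v : ℝ)) (m : ℕ)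
    (hm : m * r < Fintype.card W) :
    ∃ v : ℕ → W, (∀ i j, i < j → j ≤ m → G.Adj (v i) (v j)) ∧
      (∀ i j, i ≤ j → j ≤ m → y (v i) ≤ y (v j)) ∧
      (∀ i ≤ m, ((Finset.univ.filter fun w => y w < y (v i)).card : ℝ) ≤ i * r) ∧
      ∀ w, (∀ i < m, G.Adj (v i) w) → y (v m) ≤ y w := by
  induction m with
  | zero =>
    have : Nonempty W := Fintype.card_pos_iff.1 (by simpa using hm)
    obtain ⟨u, hu⟩ := Finite.exists_min y
    refine ⟨fun _ => u, fun i j hij hj => by omega, fun _ _ _ _ => le_rfl, fun i hi => ?_,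
      fun w _ => hu w⟩
    rw [Finset.filter_false_of_mem fun w _ => (hu w).not_gt]
    simpa using mul_nonneg i.cast_nonneg hr
  | succ m ih =>
    push_cast at hm
    obtain ⟨v, hadj, hmono, hcard, hmin⟩ := ih (by linarith)
    let N : Finset W := Finset.univ.filter fun w => ∀ i ∈ Finset.range (m + 1), G.Adj (v i) w
    have hcompl : ((Nᶜ).card : ℝ) ≤ (m + 1) * r := by
      have hsub : Nᶜ ⊆ (Finset.range (m + 1)).biUnion
          fun i => Finset.univ.filter fun w => ¬ G.Adj (v i) w := by
        intro w hw
        simpa [N] using hw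
      have hone : ∀ i, ((Finset.univ.filter fun w => ¬ G.Adj (v i) w).card : ℝ) ≤ r := by
        intro i
        have h1 := Finset.card_filter_add_card_filter_not (s := (Finset.univ : Finset W))
          (fun w => G.Adj (v i) w)
        have h2 : ndeg G (v i) = (Finset.univ.filter fun w => G.Adj (v i) w).card := by
          rw [ndeg, Set.ncard_eq_toFinset_card']
          congr 1
          ext w
          simp
        have h3 := hdeg (v i)
        rw [h2] at h3
        rw [Finset.card_univ] at h1
        have h4 : ((Finset.univ.filter fun w => G.Adj (v i) w).card : ℝ) +
          (Finset.univ.filter fun w => ¬ G.Adj (v i) w).card = Fintype.card W := mod_cast h1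
        linarith
      calc ((Nᶜ).card : ℝ) ≤ ((∑ i ∈ Finset.range (m + 1),
            (Finset.univ.filter fun w => ¬ G.Adj (v i) w).card : ℕ) : ℝ) := by
            exact_mod_cast (Finset.card_le_card hsub).trans Finset.card_biUnion_le
        _ ≤ ∑ _i ∈ Finset.range (m + 1), r := by
            push_cast
            exact Finset.sum_le_sum fun i _ => hone i
        _ = (m + 1) * r := by simp
    have hne : N.Nonempty := by
      rw [Finset.nonempty_iff_ne_empty]
      intro h0
      rw [h0, Finset.compl_empty, Finset.card_univ] at hcompl
      linarith
    obtain ⟨u, huN, hu⟩ := N.exists_min_image y hne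
    have huadj : ∀ i < m + 1, G.Adj (v i) u := by simpa [N] using huN
    let v' : ℕ → W := fun i => if i ≤ m then v i else u
    have hv' : ∀ i ≤ m, v' i = v i := fun i hi => if_pos hi
    have hu' : v' (m + 1) = u := if_neg (by omega)
    refine ⟨v', ?_, ?_, ?_, ?_⟩
    · intro i j hij hj
      rcases hj.lt_or_eq with hj | rfl
      · rw [hv' i (by omega), hv' j (by omega)]
        exact hadj i j hij (by omega)
      · rw [hv' i (by omega), hu']
        exact huadj i hij
    · intro i j hij hj
      rcases hj.lt_or_eq with hj | rfl
      · rw [hv' i (by omega), hv' j (by omega)]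
        exact hmono i j hij (by omega)
      · rcases hij.lt_or_eq with hij | rfl
        · rw [hv' i (by omega), hu']
          exact (hmono i m (by omega) le_rfl).trans (hmin u fun k hk => huadj k (by omega))
        · exact le_rfl
    · intro i hi
      rcases hi.lt_or_eq with hi | rfl
      · rw [hv' i (by omega)]
        exact hcard i (by omega)
      · rw [hu']
        push_cast
        refine le_trans ?_ hcompl
        exact_mod_cast Finset.card_le_card fun w hw => by
          rw [Finset.mem_compl]
          exact fun hwN => (hu w hwN).not_gt (by simpa using hw)
    · intro w hw
      rw [hu']
      refine hu w ?_
      simp only [N, Finset.mem_filter, Finset.mem_univ, true_and, Finset.mem_range]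
      intro i hi
      rw [← hv' i (by omega)]
      exact hw i hi

/-- A lower bound for a sum in terms of its approximate quantiles `t 0 ≤ t 1 ≤ ⋯ ≤ t m`. -/
theorem quantile_sum_le_sum {W : Type} [Fintype W] (y : W → ℝ) (r : ℝ) (t : ℕ → ℝ) (m : ℕ)
    (hmono : ∀ i < m, t i ≤ t (i + 1))
    (hcard : ∀ i ≤ m, ((Finset.univ.filter fun w => y w < t i).card : ℝ) ≤ i * r) :
    r * ∑ i ∈ Finset.range m, t i + (Fintype.card W - m * r) * t m ≤ ∑ w, min (y w) (t m) := by
  induction m with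
  | zero =>
    have h0 : (Finset.univ.filter fun w => y w < t 0) = ∅ := by
      simpa using hcard 0 le_rfl
    have h1 : ∀ w, min (y w) (t 0) = t 0 := fun w =>
      min_eq_right (not_lt.1 fun hw => by
        have : w ∈ Finset.univ.filter fun w => y w < t 0 := by simpa using hw
        simp [h0] at this)
    simp [h1]
  | succ m ih =>
    have ih := ih (fun i hi => hmono i (by omega)) fun i hi => hcard i (by omega)
    have hm := hmono m (by omega)
    have hc := hcard (m + 1) le_rfl
    have hpt : ∀ w, min (y w) (t m) + ((t (m + 1) - t m) -
        if y w < t (m + 1) then t (m + 1) - t m else 0) ≤ min (y w) (t (m + 1)) := by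
      intro w
      split_ifs with hw
      · rw [min_eq_left hw.le]
        linarith [min_le_left (y w) (t m)]
      · rw [min_eq_right (not_lt.1 hw)]
        linarith [min_le_right (y w) (t m)]
    have hsum := Finset.sum_le_sum fun w (_ : w ∈ Finset.univ) => hpt w
    rw [Finset.sum_add_distrib, Finset.sum_sub_distrib, ← Finset.sum_filter, Finset.sum_const,
      Finset.sum_const, nsmul_eq_mul, nsmul_eq_mul, Finset.card_univ] at hsum
    have hmul := mul_le_mul_of_nonneg_right hc (sub_nonneg.2 hm)
    rw [Finset.sum_range_succ]
    push_cast at hmul ⊢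
    linarith

/-- A colouring attaining `α(F)`, with colours sorted by decreasing size of the classes. -/
theorem exists_sorted_coloring {α : Type} [Fintype α] (F : SimpleGraph α)
    (hF : F.edgeSet.Nonempty) :
    ∃ (m : ℕ) (C : F.Coloring (Fin (m + 1))) (c : Fin (m + 1) → ℕ),
      (∀ i, c i = (Finset.univ.filter fun u => C u = i).card) ∧ Antitone c ∧ 0 < m ∧
      0 < c (Fin.last m) ∧
      critR F = m / (1 - (c (Fin.last m) : ℝ) / Fintype.card α) := by
  obtain ⟨e, he⟩ := hF
  induction e using Sym2.ind with | _ a b =>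
  have hab : F.Adj a b := he
  have hcol : F.Colorable (chromNum F) := F.colorable_chromaticNumber_of_fintype
  have hchi : F.chromaticNumber = (chromNum F : ℕ∞) :=
    (ENat.natCast_toNat (SimpleGraph.chromaticNumber_ne_top_iff_exists.2 ⟨_, hcol⟩)).symm
  have h2 : 2 ≤ chromNum F := by
    have := SimpleGraph.two_le_chromaticNumber_of_adj hab
    rw [hchi] at this
    exact_mod_cast this
  have hsurj := (SimpleGraph.chromaticNumber_eq_iff_forall_surjective hcol).1 hchi
  obtain ⟨m, hm⟩ : ∃ m, chromNum F = m + 1 := ⟨chromNum F - 1, by omega⟩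
  have hne : {a | ∃ C, ProperCol F (chromNum F) C ∧ a = minClassCard C (chromNum F)}.Nonempty := by
    obtain ⟨C⟩ := hcol
    exact ⟨_, fun u => (C u : ℕ), ⟨fun u => (C u).2, fun u v huv h =>
      C.valid huv (Fin.ext h)⟩, rfl⟩
  obtain ⟨C, ⟨hClt, hC⟩, hmin⟩ := Nat.sInf_mem hne
  change alphaNat F = _ at hmin
  have hne' : {a | ∃ i < chromNum F, a = classCard C i}.Nonempty := ⟨_, 0, by omega, rfl⟩
  obtain ⟨i₀, hi₀, hi₀min⟩ := Nat.sInf_mem hne'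
  change minClassCard C (chromNum F) = _ at hi₀min
  have hle : ∀ i < chromNum F, alphaNat F ≤ classCard C i := fun i hi => by
    rw [hmin]
    exact Nat.sInf_le ⟨i, hi, rfl⟩
  rw [hm] at hClt hi₀ hle hsurj
  let C₀ : F.Coloring (Fin (m + 1)) := SimpleGraph.Coloring.mk (fun u => ⟨C u, hClt u⟩)
    fun {u v} huv h => hC huv (congrArg Fin.val h)
  have hclass : ∀ i : Fin (m + 1),
      (Finset.univ.filter fun u => C₀ u = i).card = classCard C i := fun i => by
    rw [classCard, Set.ncard_eq_toFinset_card']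
    congr 1
    ext u
    simp only [Finset.mem_filter, Finset.mem_univ, true_and, Set.mem_toFinset,
      Set.mem_ofPred_eq]
    exact Fin.ext_iff
  let g : Fin (m + 1) → ℕᵒᵈ := fun i => OrderDual.toDual (classCard C i)
  let σ := Tuple.sort g
  let c : Fin (m + 1) → ℕ := fun i => classCard C (σ i)
  have hanti : Antitone c := fun i j hij => Tuple.monotone_sort g hij
  have hlast : c (Fin.last m) = alphaNat F := by
    refine le_antisymm ?_ (hle _ (σ _).2)
    have h := hanti (Fin.le_last (σ.symm ⟨i₀, hi₀⟩))
    rw [hmin, hi₀min]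
    simpa [c] using h
  let C₁ : F.Coloring (Fin (m + 1)) := SimpleGraph.Coloring.mk (fun u => σ.symm (C₀ u))
    fun {u v} huv h => C₀.valid huv (σ.symm.injective h)
  have hc : ∀ i, c i = (Finset.univ.filter fun u => C₁ u = i).card := fun i => by
    change classCard C (σ i) = _
    rw [← hclass]
    congr 1
    ext u
    simp only [Finset.mem_filter, Finset.mem_univ, true_and]
    exact σ.symm_apply_eq.symm
  refine ⟨m, C₁, c, hc, hanti, by omega, ?_, ?_⟩
  · obtain ⟨u, hu⟩ := hsurj C₁ (Fin.last m)
    rw [hc]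
    exact Finset.card_pos.2 ⟨u, by simpa using hu⟩
  · rw [critR, alphaR, hm, hlast]
    push_cast
    ring

/-- Some homomorphism `F → G` has `y`-weight at most what the uniform weight predicts. -/
theorem exists_hom_weight_le {α W : Type} [Fintype α] [Fintype W] [Nonempty W] (χ : ℝ)
    (hχ : 1 ≤ χ) (F : SimpleGraph α) (hF : F.edgeSet.Nonempty) (hcrit : critR F ≤ χ)
    (G : SimpleGraph W)
    (hδ : ∀ v, (1 - 1 / χ) * (Fintype.card W : ℝ) ≤ (ndeg G v : ℝ)) (y : W → ℝ) :
    ∃ θ : F →g G,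
      (Fintype.card W : ℝ) * ∑ u, y (θ u) ≤ Fintype.card α * ∑ w, y w := by
  obtain ⟨m, C, c, hc, hanti, hm, hpos, hcr⟩ := exists_sorted_coloring F hF
  have hn : (0 : ℝ) < Fintype.card W := by exact_mod_cast Fintype.card_pos
  have hmR : (0 : ℝ) < m := by exact_mod_cast hm
  have haR : (0 : ℝ) < c (Fin.last m) := by exact_mod_cast hpos
  have htot : (Fintype.card α : ℝ) = ∑ i : Fin m, (c i.castSucc : ℝ) + c (Fin.last m) := by
    have h := Finset.card_eq_sum_card_fiberwise (s := (Finset.univ : Finset α))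
      (t := Finset.univ) (f := C) fun _ _ => Finset.mem_coe.2 (Finset.mem_univ _)
    simp only [← hc] at h
    rw [Finset.card_univ, Fin.sum_univ_castSucc] at h
    exact_mod_cast h
  set h : ℝ := (Fintype.card α : ℝ)
  set n : ℝ := (Fintype.card W : ℝ)
  set a : ℝ := (c (Fin.last m) : ℝ)
  set S : ℝ := ∑ i : Fin m, (c i.castSucc : ℝ)
  have hS : 0 < S := by
    refine Finset.sum_pos (fun i _ => ?_) ⟨⟨0, hm⟩, Finset.mem_univ _⟩
    exact_mod_cast hpos.trans_le (hanti (Fin.le_last _))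
  have hh : 0 < h := by linarith
  have hcr' : critR F = m * h / S := by
    rw [hcr, show S = h - a by linarith]
    have : h - a ≠ 0 := by linarith
    field_simp
  have hinv : 1 / χ ≤ S / (m * h) := by
    rw [hcr', div_le_iff₀ hS] at hcrit
    rw [div_le_div_iff₀ (by linarith) (by positivity)]
    linarith
  set r : ℝ := n * (S / (m * h)) with hr_def
  have hr : 0 ≤ r := by positivity
  have hmr : m * r = n * S / h := by
    rw [hr_def]
    field_simp
  have hdeg : ∀ v, n - r ≤ (ndeg G v : ℝ) := fun v => by
    have := mul_le_mul_of_nonneg_left hinv hn.le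
    linarith [hδ v]
  obtain ⟨v, hadj, hmono, hcard, -⟩ := exists_greedy_clique_s7 G y r hr hdeg m (by
    rw [hmr, div_lt_iff₀ hh]
    exact mul_lt_mul_of_pos_left (by linarith) hn)
  have hq := quantile_sum_le_sum y r (fun i => y (v i)) m
    (fun i hi => hmono i (i + 1) (by omega) (by omega)) hcard
  have hminle : ∑ w, min (y w) (y (v m)) ≤ ∑ w, y w :=
    Finset.sum_le_sum fun w _ => min_le_left _ _
  refine ⟨⟨fun u => v (C u), fun {u u'} huu' => ?_⟩, ?_⟩
  · rcases lt_or_gt_of_ne (C.valid huu') with hlt | hlt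
    · exact hadj _ _ hlt (by omega)
    · exact (hadj _ _ hlt (by omega)).symm
  change n * ∑ u, y (v (C u)) ≤ _
  have hfib : ∑ u, y (v (C u)) = ∑ i : Fin m, (c i.castSucc : ℝ) * y (v i) + a * y (v m) := by
    rw [← Finset.sum_fiberwise Finset.univ C]
    have : ∀ i : Fin (m + 1), ∑ u ∈ Finset.univ.filter (fun u => C u = i), y (v (C u)) =
        c i * y (v i) := fun i => by
      rw [hc, ← nsmul_eq_mul, ← Finset.sum_const]
      refine Finset.sum_congr rfl fun u hu => ?_
      rw [(Finset.mem_filter.1 hu).2]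
    simp only [this]
    rw [Fin.sum_univ_castSucc]
    rfl
  have hcheb : (m : ℝ) * ∑ i : Fin m, (c i.castSucc : ℝ) * y (v i) ≤
      S * ∑ i : Fin m, y (v i) := by
    have hav : Antivary (fun i : Fin m => (c i.castSucc : ℝ)) fun i : Fin m => y (v i) := by
      refine Antitone.antivary (fun i j hij => ?_) fun i j hij => hmono _ _ hij (by omega)
      exact_mod_cast hanti (Fin.castSucc_le_castSucc_iff.2 hij)
    simpa using hav.card_mul_sum_le_sum_mul_sum
  rw [Finset.sum_range fun i => y (v i), hmr] at hq
  set T : ℝ := ∑ i : Fin m, y (v i)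
  rw [hfib]
  have hq' := mul_le_mul_of_nonneg_left (hq.trans hminle) (mul_pos hmR hh).le
  have hexp : m * h * (r * T + (n - n * S / h) * y (v m)) =
      n * (S * T) + m * (n * a * y (v m)) := by
    rw [hr_def, show a = h - S by linarith]
    field_simp
  rw [hexp] at hq'
  refine le_of_mul_le_mul_left ?_ hmR
  linarith [mul_le_mul_of_nonneg_left hcheb hn.le]

/-- Lemma 5.1 (fractional Komlós theorem). -/
theorem degree_frac_bottle_tiling (χ : ℝ) (hχ : 1 ≤ χ) {α W : Type} [Fintype α] [Fintype W]
    (F : SimpleGraph α) (hF : F.edgeSet.Nonempty) (hcrit : critR F ≤ χ)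
    (G : SimpleGraph W)
    (hδ : ∀ v, (1 - 1 / χ) * (Fintype.card W : ℝ) ≤ (ndeg G v : ℝ)) :
    ∃ ω, IsFracTiling F G ω ∧ fracWeight F G ω = (Fintype.card W : ℝ) := by
  obtain ⟨e, he⟩ := id hF
  have hα : Nonempty α := by
    induction e using Sym2.ind with | _ a b => exact ⟨a⟩
  rcases isEmpty_or_nonempty W with hW | hW
  · have : IsEmpty (F →g G) := ⟨fun θ => hW.elim (θ hα.some)⟩
    exact ⟨0, ⟨fun θ => isEmptyElim θ, fun v => isEmptyElim v⟩, by simp [fracWeight]⟩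
  have : Finite (F →g G) := DFunLike.finite _
  have := Fintype.ofFinite (F →g G)
  have hn : (0 : ℝ) < Fintype.card W := by exact_mod_cast Fintype.card_pos
  have hh : (0 : ℝ) < Fintype.card α := by exact_mod_cast Fintype.card_pos
  have hfib : ∀ (θ : F →g G) (w : W),
      ({u | θ u = w}.ncard : ℝ) = (Finset.univ.filter fun u => θ u = w).card := fun θ w => by
    rw [Set.ncard_eq_toFinset_card']
    congr 2
    ext u
    simp
  have hweight : ∀ (θ : F →g G) (y : W → ℝ),
      ∑ w, y w * ({u | θ u = w}.ncard : ℝ) = ∑ u, y (θ u) := fun θ y => by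
    rw [← Finset.sum_fiberwise Finset.univ θ]
    refine Finset.sum_congr rfl fun w _ => ?_
    rw [hfib, mul_comm, ← nsmul_eq_mul, ← Finset.sum_const]
    refine Finset.sum_congr rfl fun u hu => ?_
    rw [(Finset.mem_filter.1 hu).2]
  obtain ⟨p, ⟨hp0, hp1⟩, hp⟩ := exists_mem_stdSimplex_sum_eq
    (fun (θ : F →g G) (w : W) => ({u | θ u = w}.ncard : ℝ) / Fintype.card α)
    (fun _ => 1 / (Fintype.card W : ℝ))
    (fun θ => by
      have := hweight θ 1
      simp only [Pi.one_apply, one_mul, Finset.sum_const, Finset.card_univ, nsmul_eq_mul,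
        mul_one] at this
      rw [← Finset.sum_div, this, div_self hh.ne'])
    (by simp)
    (fun y hy => by
      obtain ⟨θ, hθ⟩ := exists_hom_weight_le χ hχ F hF hcrit G hδ y
      have := hy θ
      simp only [← mul_div_assoc, mul_one] at this ⊢
      rw [← Finset.sum_div, hweight] at this
      rw [← Finset.sum_div]
      have hpos := (div_pos_iff_of_pos_right hh).1 this
      have hsum : 0 < (Fintype.card α : ℝ) * ∑ w, y w := (mul_pos hn hpos).trans_le hθ
      exact div_nonneg (pos_of_mul_pos_right hsum hh.le).le hn.le)
  have hload : ∀ w, ∑ θ : F →g G,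
      p θ * (Fintype.card W / Fintype.card α) * ({u | θ u = w}.ncard : ℝ) = 1 := fun w => by
    have h1 := congrArg (fun x => (Fintype.card W : ℝ) * x) (hp w)
    simp only [Finset.mul_sum] at h1
    rw [mul_one_div_cancel hn.ne'] at h1
    rw [← h1]
    exact Finset.sum_congr rfl fun θ _ => by ring
  have hnonneg : ∀ θ, 0 ≤ p θ * (Fintype.card W / Fintype.card α : ℝ) := fun θ =>
    mul_nonneg (hp0 θ) (by positivity)
  refine ⟨fun θ => p θ * (Fintype.card W / Fintype.card α), ⟨fun θ => ⟨hnonneg θ, ?_⟩,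
    fun w => ?_⟩, ?_⟩
  · have hone : (1 : ℝ) ≤ ({u | θ u = θ hα.some}.ncard : ℝ) := by
      rw [hfib]
      exact_mod_cast Finset.card_pos.2 ⟨hα.some, by simp⟩
    refine (le_mul_of_one_le_right (hnonneg θ) hone).trans ?_
    rw [← hload (θ hα.some)]
    exact Finset.single_le_sum (f := fun θ' : F →g G => p θ' *
      (Fintype.card W / Fintype.card α) * ({u | θ' u = θ hα.some}.ncard : ℝ))
      (fun θ' _ => mul_nonneg (hnonneg θ') (Nat.cast_nonneg _)) (Finset.mem_univ θ)
  · rw [finsum_eq_sum_of_fintype]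
    exact (hload w).le
  · rw [fracWeight, finsum_eq_sum_of_fintype, ← Finset.sum_mul, hp1, one_mul]
    field_simp

end Paper
end

section
/- Let k ≥ 2 and δ > (k−2)/(k−1), and let G be a graph on n vertices with minimum degree δ(G) ≥ δn; set δ′ = δ − (k−2)/(k−1). Then every tight component T of K_k(G) satisfies e(T) > (δ′n)(δ′n−1)⋯(δ′n−k+1)/k! (the generalized binomial coefficient C(δ′n, k)). -/
open scoped Classical

namespace Paper

/-- If every set obtained from a member of a nonempty `k`-uniform family by removing one point
extends to a member in at least `x` ways, then the family has at least
`x (x + 1) ⋯ (x + k - 1) / k!` members. -/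
theorem prod_le_factorial_mul_card {V : Type} [Fintype V] {x : ℝ} (hx : 0 ≤ x) (k : ℕ)
    (F : Finset (Finset V)) (hne : F.Nonempty) (hcard : ∀ e ∈ F, e.card = k)
    (hdeg : ∀ e ∈ F, ∀ v ∈ e, x ≤
      ((Finset.univ.filter fun w => w ∉ e.erase v ∧ insert w (e.erase v) ∈ F).card : ℝ)) :
    ∏ i ∈ Finset.range k, (x + i) ≤ (k.factorial : ℝ) * F.card := by
  induction k generalizing F with
  | zero =>
    have : (1 : ℝ) ≤ F.card := by exact_mod_cast hne.card_pos
    simpa using this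
  | succ k ih =>
    have hP : 0 ≤ ∏ i ∈ Finset.range k, (x + i) :=
      Finset.prod_nonneg fun i _ => by positivity
    set U : Finset V := Finset.univ.filter fun v => ∃ e ∈ F, v ∈ e with hU
    have hcount : ∑ v, (F.memberSubfamily v).card = (k + 1) * F.card := by
      have h1 : ∀ v, (F.memberSubfamily v).card = (F.filter fun e => v ∈ e).card := by
        intro v
        rw [Finset.memberSubfamily, Finset.card_image_of_injOn]
        exact (Finset.erase_injOn' v).mono fun s hs => by simpa using (Finset.mem_filter.1 hs).2
      have h2 := Finset.sum_card_bipartiteAbove_eq_sum_card_bipartiteBelow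
        (s := (Finset.univ : Finset V)) (t := F) (fun v e => v ∈ e)
      simp only [Finset.bipartiteAbove, Finset.bipartiteBelow, Finset.filter_univ_mem] at h2
      rw [Finset.sum_congr rfl fun v _ => h1 v, h2, Finset.sum_congr rfl hcard,
        Finset.sum_const, smul_eq_mul, mul_comm]
    have hlink : ∀ v ∈ U, ∏ i ∈ Finset.range k, (x + i) ≤
        (k.factorial : ℝ) * (F.memberSubfamily v).card := by
      intro v hv
      obtain ⟨e, he, hve⟩ := (Finset.mem_filter.1 hv).2
      refine ih _ ⟨e.erase v, ?_⟩ ?_ ?_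
      · simp [Finset.mem_memberSubfamily, Finset.insert_erase hve, he]
      · intro s hs
        rw [Finset.mem_memberSubfamily] at hs
        have := hcard _ hs.1
        rw [Finset.card_insert_of_notMem hs.2] at this
        omega
      · intro s hs u hu
        rw [Finset.mem_memberSubfamily] at hs
        have hvu : v ≠ u := fun h => hs.2 (h ▸ hu)
        refine (hdeg _ hs.1 u (Finset.mem_insert_of_mem hu)).trans ?_
        rw [Finset.erase_insert_of_ne hvu]
        refine Nat.cast_le.2 (Finset.card_le_card fun w hw => ?_)
        simp only [Finset.mem_filter, Finset.mem_univ, true_and, Finset.mem_insert,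
          not_or] at hw ⊢
        refine ⟨hw.1.2, ?_⟩
        rw [Finset.mem_memberSubfamily, Finset.insert_comm]
        refine ⟨hw.2, ?_⟩
        rw [Finset.mem_insert, not_or]
        exact ⟨fun h => hw.1.1 h.symm, fun h => hs.2 (Finset.mem_of_mem_erase h)⟩
    have hUcard : x + k ≤ U.card := by
      obtain ⟨e, he⟩ := hne
      obtain ⟨v, hv⟩ : e.Nonempty := Finset.card_pos.1 (by rw [hcard e he]; omega)
      have hsub : e.erase v ∪
          (Finset.univ.filter fun w => w ∉ e.erase v ∧ insert w (e.erase v) ∈ F) ⊆ U := by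
        intro w hw
        refine Finset.mem_filter.2 ⟨Finset.mem_univ _, ?_⟩
        rcases Finset.mem_union.1 hw with h | h
        · exact ⟨e, he, Finset.mem_of_mem_erase h⟩
        · exact ⟨_, (Finset.mem_filter.1 h).2.2, Finset.mem_insert_self _ _⟩
      have hle := Finset.card_le_card hsub
      rw [Finset.card_union_of_disjoint
        (Finset.disjoint_right.2 fun w hw => (Finset.mem_filter.1 hw).2.1),
        Finset.card_erase_of_mem hv, hcard e he, Nat.add_sub_cancel] at hle
      have hle' := (Nat.cast_le (α := ℝ)).2 hle
      push_cast at hle'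
      linarith [hdeg e he v hv]
    calc ∏ i ∈ Finset.range (k + 1), (x + i)
        = (x + k) * ∏ i ∈ Finset.range k, (x + i) := by rw [Finset.prod_range_succ, mul_comm]
      _ ≤ U.card * ∏ i ∈ Finset.range k, (x + i) := by gcongr
      _ = ∑ v ∈ U, ∏ i ∈ Finset.range k, (x + i) := by rw [Finset.sum_const, nsmul_eq_mul]
      _ ≤ ∑ v ∈ U, (k.factorial : ℝ) * (F.memberSubfamily v).card := Finset.sum_le_sum hlink
      _ ≤ ∑ v, (k.factorial : ℝ) * (F.memberSubfamily v).card :=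
          Finset.sum_le_sum_of_subset_of_nonneg (Finset.subset_univ _)
            fun _ _ _ => by positivity
      _ = ((k + 1).factorial : ℝ) * F.card := by
          rw [← Finset.mul_sum, ← Nat.cast_sum, hcount, Nat.factorial_succ]
          push_cast
          ring

/-- A set `s` of vertices in a graph of minimum degree at least `d` has at least
`|V| - |s| (|V| - d)` common neighbours. -/
theorem le_card_common_neighbors {V : Type} [Fintype V] (G : SimpleGraph V) {d : ℝ}
    (hd : ∀ v, d ≤ (ndeg G v : ℝ)) (s : Finset V) :
    (Fintype.card V : ℝ) - s.card * (Fintype.card V - d) ≤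
      ((Finset.univ.filter fun w => ∀ u ∈ s, G.Adj u w).card : ℝ) := by
  have hdeg : ∀ v, (Finset.univ.filter fun w => G.Adj v w).card = ndeg G v := by
    intro v
    rw [ndeg, Set.ncard_eq_toFinset_card']
    congr 1
    ext w
    simp
  induction s using Finset.induction_on with
  | empty => simp
  | insert a s ha ih =>
    set A := Finset.univ.filter fun w => ∀ u ∈ s, G.Adj u w
    set B := Finset.univ.filter fun w => G.Adj a w with hB
    have hAB : (Finset.univ.filter fun w => ∀ u ∈ insert a s, G.Adj u w) = A ∩ B := by
      ext w
      simp [A, B, and_comm]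
    have h1 := Finset.card_union_add_card_inter A B
    have h2 : (A ∪ B).card ≤ Fintype.card V := Finset.card_le_univ _
    have h3 : (A.card : ℝ) + B.card ≤ Fintype.card V + (A ∩ B).card := by
      exact_mod_cast (by omega : A.card + B.card ≤ Fintype.card V + (A ∩ B).card)
    have h4 : d ≤ B.card := by rw [hB, hdeg]; exact hd a
    rw [hAB, Finset.card_insert_of_notMem ha]
    push_cast
    linarith

/-- If every vertex set of size `k - 1` has at least `x ≥ 0` common neighbours in `G`, then
every tight component of the `k`-clique hypergraph of `G` has at least
`x (x + 1) ⋯ (x + k - 1) / k!` edges. -/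
theorem prod_le_factorial_mul_ncard_tight {V : Type} [Fintype V] (G : SimpleGraph V) (k : ℕ)
    {x : ℝ} (hx : 0 ≤ x)
    (hcommon : ∀ s : Finset V, s.card = k - 1 →
      x ≤ ((Finset.univ.filter fun w => ∀ u ∈ s, G.Adj u w).card : ℝ))
    (c : (TGraph k (G.cliqueSet k)).ConnectedComponent) :
    ∏ i ∈ Finset.range k, (x + i) ≤ (k.factorial : ℝ) *
      ({e : ↥(G.cliqueSet k) |
        (TGraph k (G.cliqueSet k)).connectedComponentMk e = c}.ncard : ℝ) := by
  set S := {e : ↥(G.cliqueSet k) | (TGraph k (G.cliqueSet k)).connectedComponentMk e = c}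
  have hF : ∀ s, s ∈ S.toFinset.image Subtype.val ↔ ∃ h : s ∈ G.cliqueSet k,
      (TGraph k (G.cliqueSet k)).connectedComponentMk ⟨s, h⟩ = c := by
    intro s
    simp [S]
  have hcard : (S.toFinset.image Subtype.val).card = S.ncard := by
    rw [Finset.card_image_of_injective _ Subtype.val_injective, Set.ncard_eq_toFinset_card']
  rw [← hcard]
  refine prod_le_factorial_mul_card hx k _ ?_ ?_ ?_
  · obtain ⟨e, he⟩ := c.exists_rep
    exact ⟨e.1, (hF _).2 ⟨e.2, he⟩⟩
  · intro e he
    exact ((hF e).1 he).1.card_eq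
  · intro e he v hv
    obtain ⟨hclique, hc⟩ := (hF e).1 he
    have hs : (e.erase v).card = k - 1 := by
      rw [Finset.card_erase_of_mem hv, hclique.card_eq]
    have hk : 1 ≤ k := by
      rw [← hclique.card_eq]
      exact Finset.card_pos.2 ⟨v, hv⟩
    refine (hcommon _ hs).trans (Nat.cast_le.2 (Finset.card_le_card fun w hw => ?_))
    simp only [Finset.mem_filter, Finset.mem_univ, true_and] at hw ⊢
    have hw' : w ∉ e.erase v := fun h => G.loopless.irrefl w (hw w h)
    refine ⟨hw', (hF _).2 ?_⟩
    have hnew : insert w (e.erase v) ∈ G.cliqueSet k := by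
      rw [SimpleGraph.mem_cliqueSet_iff, SimpleGraph.isNClique_iff]
      refine ⟨?_, by rw [Finset.card_insert_of_notMem hw', hs]; omega⟩
      rw [Finset.coe_insert, SimpleGraph.isClique_insert]
      exact ⟨hclique.isClique.subset (by simp), fun u hu _ => (hw u hu).symm⟩
    refine ⟨hnew, ?_⟩
    rw [← hc, SimpleGraph.ConnectedComponent.eq]
    by_cases hwv : insert w (e.erase v) = e
    · simp [hwv]
    · refine SimpleGraph.Adj.reachable ?_
      rw [TGraph, SimpleGraph.fromRel_adj]
      refine ⟨fun h => hwv (congrArg Subtype.val h), Or.inl ?_⟩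
      have hwe : w ∉ e := fun h => by
        have hwv' : w = v := by
          by_contra hne
          exact hw' (Finset.mem_erase.2 ⟨hne, h⟩)
        exact hwv (by rw [hwv', Finset.insert_erase hv])
      rw [Finset.insert_inter_of_notMem hwe,
        Finset.inter_eq_left.2 (Finset.erase_subset _ _), hs]

theorem prod_sub_lt_prod_add {x : ℝ} (hx : 0 < x) {k : ℕ} (hk : 2 ≤ k) :
    ∏ i ∈ Finset.range k, (x - i) < ∏ i ∈ Finset.range k, (x + i) := by
  obtain ⟨m, rfl⟩ : ∃ m, k = m + 2 := ⟨k - 2, by omega⟩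
  have habs : ∀ i : ℕ, |x - i| ≤ x + i := fun i => by
    rw [abs_le]
    constructor <;> linarith [(Nat.cast_nonneg i : (0 : ℝ) ≤ i)]
  refine (le_abs_self _).trans_lt ?_
  rw [Finset.abs_prod, Finset.prod_range_succ', Finset.prod_range_succ', Finset.prod_range_succ',
    Finset.prod_range_succ']
  have hle : ∏ i ∈ Finset.range m, |x - ((i + 1 + 1 : ℕ) : ℝ)| ≤
      ∏ i ∈ Finset.range m, (x + ((i + 1 + 1 : ℕ) : ℝ)) :=
    Finset.prod_le_prod (fun _ _ => abs_nonneg _) fun i _ => habs _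
  have hpos : 0 < ∏ i ∈ Finset.range m, (x + ((i + 1 + 1 : ℕ) : ℝ)) :=
    Finset.prod_pos fun i _ => by positivity
  have h1 : |x - ((0 + 1 : ℕ) : ℝ)| < x + ((0 + 1 : ℕ) : ℝ) := by
    rw [abs_lt]
    push_cast
    constructor <;> linarith
  have h0 : |x - ((0 : ℕ) : ℝ)| = x + ((0 : ℕ) : ℝ) := by simp [abs_of_pos hx]
  rw [h0]
  exact mul_lt_mul_of_pos_right (mul_lt_mul' hle h1 (abs_nonneg _) hpos) (by simpa using hx)

/-- Proposition 5.3 (tight components of `K_k(G)` are large). -/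
theorem decomposition (k n : ℕ) (hk : 2 ≤ k) (δ : ℝ)
    (hδk : ((k : ℝ) - 2) / ((k : ℝ) - 1) < δ) (G : SimpleGraph (Fin n))
    (hδ : ∀ v, δ * n ≤ (ndeg G v : ℝ)) :
    ∀ c : (TGraph k (G.cliqueSet k)).ConnectedComponent,
      (∏ i ∈ Finset.range k, ((δ - ((k : ℝ) - 2) / ((k : ℝ) - 1)) * n - i)) /
          (Nat.factorial k : ℝ) <
        ({e : ↥(G.cliqueSet k) |
            (TGraph k (G.cliqueSet k)).connectedComponentMk e = c}.ncard : ℝ) := by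
  intro c
  set y : ℝ := (δ - ((k : ℝ) - 2) / ((k : ℝ) - 1)) * n with hy
  have hk1 : (1 : ℝ) ≤ (k : ℝ) - 1 := by
    have : (2 : ℝ) ≤ k := by exact_mod_cast hk
    linarith
  have hn : 0 < n := by
    obtain ⟨e, -⟩ := c.exists_rep
    obtain ⟨v, -⟩ : e.1.Nonempty := Finset.card_pos.1 (by rw [e.2.card_eq]; omega)
    exact v.pos
  have hypos : 0 < y := mul_pos (sub_pos.2 hδk) (by exact_mod_cast hn)
  have hmain := prod_le_factorial_mul_ncard_tight G k hypos.le (fun s hs => by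
    refine le_trans ?_ (le_card_common_neighbors G hδ s)
    rw [hs, Fintype.card_fin, Nat.cast_sub (by omega), Nat.cast_one]
    have hcalc : (n : ℝ) - ((k : ℝ) - 1) * (n - δ * n) = ((k : ℝ) - 1) * y := by
      rw [hy]
      field_simp
      ring
    rw [hcalc]
    exact le_mul_of_one_le_left hypos.le hk1) c
  rw [div_lt_iff₀' (by positivity)]
  exact (prod_sub_lt_prod_add hypos hk).trans_le hmain

end Paper
end
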